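/- arXiv:math/0409517 — 3 statements merged into one kernel-verified Lean document; each statement's English description precedes it below -/
import Mathlib

section
/- Let R be a commutative Bézout ring of Krull dimension at most one. If MinSpec(R) is compact, then R is a Kaplansky ring. -/
open DirectSum

universe u

/-- A finite `n`-presentation of an `R`-module `E`: an exact sequence
`F_n → ⋯ → F_1 → F_0 → E → 0` with each `F_i` a finitely generated free module. -/
def HasFiniteNPresentation (R : Type u) [CommRing R] (E : Type u) [AddCommGroup E]
    [Module R E] (n : ℕ) : Prop :=
  ∃ (k : ℕ → ℕ) (f : ∀ i : ℕ, ((Fin (k (i + 1)) → R) →ₗ[R] (Fin (k i) → R)))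
    (g : ((Fin (k 0) → R) →ₗ[R] E)),
    Function.Surjective g ∧
    (0 < n → LinearMap.range (f 0) = LinearMap.ker g) ∧
    (∀ i : ℕ, i + 1 < n → LinearMap.range (f (i + 1)) = LinearMap.ker (f i))

/-- `λ-dim R ≤ n` : every module having a finite `n`-presentation has finite
`m`-presentations for all `m`, i.e. `λ_R(E) ≥ n → λ_R(E) = ∞`. -/
def LambdaDimLE (R : Type u) [CommRing R] (n : ℕ) : Prop :=
  ∀ (E : Type u) [AddCommGroup E] [Module R E],
    HasFiniteNPresentation R E n → ∀ m : ℕ, HasFiniteNPresentation R E m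

/-- `R` is arithmetic: the localization at every maximal ideal is a valuation ring,
i.e. its ideals are totally ordered by inclusion. -/
def IsArithmetic (R : Type u) [CommRing R] : Prop :=
  ∀ (M : Ideal R) (hM : M.IsMaximal),
    letI := hM.isPrime
    ∀ I J : Ideal (Localization.AtPrime M), I ≤ J ∨ J ≤ I

/-- `R` is self fp-injective: `Ext¹_R(F, R) = 0` for every finitely presented module `F`. -/
def SelfFPInjective (R : Type u) [CommRing R] : Prop :=
  ∀ (F : ModuleCat.{u} R), Module.FinitePresentation R F →
    Subsingleton (((Ext R (ModuleCat.{u} R) 1).obj (Opposite.op F)).obj (ModuleCat.of R R))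

/-- A coherent ring: every finitely generated ideal is finitely presented. -/
def IsCoherentRing (R : Type u) [CommRing R] : Prop :=
  ∀ I : Ideal R, I.FG → Module.FinitePresentation R I

/-- flat dimension of `E` at most `n`: the least `m` such that
`Tor_{m+1}(F, E) = 0` for all `F` is at most `n`. -/
def FlatDimLE (R : Type u) [CommRing R] (E : Type u) [AddCommGroup E] [Module R E]
    (n : ℕ) : Prop :=
  ∃ m ≤ n, ∀ (F : Type u) [AddCommGroup F] [Module R F],
    Subsingleton (((CategoryTheory.Tor (ModuleCat.{u} R) (m + 1)).obj (ModuleCat.of R F)).obj (ModuleCat.of R E))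

/-- Hermite ring. -/
def IsHermiteRing (R : Type u) [CommRing R] : Prop :=
  ∀ a b : R, ∃ d a' b' : R, a = d * a' ∧ b = d * b' ∧
    Ideal.span {a'} + Ideal.span {b'} = ⊤

/-- Kaplansky (elementary divisor) ring. -/
def IsKaplanskyRing (R : Type u) [CommRing R] : Prop :=
  ∀ (m n : ℕ) (A : Matrix (Fin m) (Fin n) R),
    ∃ (P : Matrix (Fin m) (Fin m) R) (Q : Matrix (Fin n) (Fin n) R),
      IsUnit P ∧ IsUnit Q ∧ ∀ (i : Fin m) (j : Fin n), (i : ℕ) ≠ (j : ℕ) → (P * A * Q) i j = 0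

/-- Adequate ring. -/
def IsAdequateRing (R : Type u) [CommRing R] : Prop :=
  IsBezout R ∧ ∀ a b : R, a ≠ 0 → ∃ r s : R,
    a = r * s ∧ Ideal.span {r} + Ideal.span {b} = ⊤ ∧
    ∀ s' : R, ¬ IsUnit s' → s' ∣ s → Ideal.span {s'} + Ideal.span {b} ≠ ⊤

/-- The minimal prime spectrum with the subspace topology from `Spec R`. -/
def MinSpec (R : Type u) [CommRing R] : Type u :=
  {P : PrimeSpectrum R // P.asIdeal ∈ minimalPrimes R}

instance (R : Type u) [CommRing R] : TopologicalSpace (MinSpec R) :=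
  instTopologicalSpaceSubtype

/-- Fractionally self fp-injective: for every proper ideal `A`, the classical
quotient ring `Q(R/A)` is self fp-injective. -/
def FractionallySelfFPInjective (R : Type u) [CommRing R] : Prop :=
  ∀ A : Ideal R, A ≠ ⊤ → SelfFPInjective (FractionRing (R ⧸ A))

/-- CF ring: every finite direct sum of cyclic modules has a canonical form. -/
def IsCFRing (R : Type u) [CommRing R] : Prop :=
  ∀ (n : ℕ) (I : Fin n → Ideal R),
    ∃ (m : ℕ) (J : Fin m → Ideal R),
      (∀ i j : Fin m, i ≤ j → J i ≤ J j) ∧ (∀ j : Fin m, J j ≠ ⊤) ∧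
      Nonempty ((⨁ i, R ⧸ I i) ≃ₗ[R] (⨁ j, R ⧸ J j))

/-- An element of a minimal prime `P` is annihilated, up to nilpotents, by an element outside `P`. -/
theorem Ideal.exists_notMem_isNilpotent_mul_of_mem_minimalPrimes {R : Type*} [CommRing R]
    {P : Ideal R} (hP : P ∈ minimalPrimes R) {x : R} (hx : x ∈ P) :
    ∃ y ∉ P, IsNilpotent (x * y) := by
  have := hP.1.1
  by_contra! h
  have hdisj : Disjoint ((⊥ : Ideal R) : Set R)
      (Submonoid.powers x ⊔ P.primeCompl : Submonoid R) := by
    rw [Set.disjoint_left]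
    rintro z hz hz'
    obtain ⟨_, ⟨n, rfl⟩, y, hy, rfl⟩ := Submonoid.mem_sup.1 hz'
    refine h y hy ⟨n + 1, ?_⟩
    have hz : x ^ n * y = 0 := hz
    calc (x * y) ^ (n + 1) = x ^ n * y * (x * y ^ n) := by ring
      _ = 0 := by rw [hz, zero_mul]
  obtain ⟨Q, hQ, -, hQd⟩ := Ideal.exists_le_prime_disjoint _ _ hdisj
  have hQP : Q ≤ P := fun z hz => by
    by_contra hzP
    exact Set.disjoint_left.1 hQd hz (Submonoid.mem_sup_right (show z ∈ P.primeCompl from hzP))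
  exact Set.disjoint_left.1 hQd (hP.2 ⟨hQ, bot_le⟩ hQP hx)
    (Submonoid.mem_sup_left (Submonoid.mem_powers x))

/-- In a Bézout ring with compact minimal spectrum, every element `x` has a complement `y`: the
product `x * y` is nilpotent and no minimal prime contains both. -/
theorem exists_isNilpotent_mul_forall_minimalPrimes {R : Type u} [CommRing R] [IsBezout R]
    [CompactSpace (MinSpec R)] (x : R) :
    ∃ y, IsNilpotent (x * y) ∧ ∀ P ∈ minimalPrimes R, ¬ (x ∈ P ∧ y ∈ P) := by
  have hopen (y : R) : IsOpen {P : MinSpec R | y ∉ P.1.asIdeal} :=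
    (PrimeSpectrum.isOpen_basicOpen (a := y)).preimage
      (continuous_subtype_val : Continuous fun P : MinSpec R => P.1)
  have hclosed : IsClosed {P : MinSpec R | x ∈ P.1.asIdeal} := isOpen_compl_iff.1 (hopen x)
  obtain ⟨t, ht⟩ := hclosed.isCompact.elim_finite_subcover
    (fun y : {y : R // IsNilpotent (x * y)} => {P : MinSpec R | y.1 ∉ P.1.asIdeal})
    (fun y => hopen y.1) (by
    intro P hP
    obtain ⟨y, hy, hxy⟩ := Ideal.exists_notMem_isNilpotent_mul_of_mem_minimalPrimes P.2 hP
    exact Set.mem_iUnion.2 ⟨⟨y, hxy⟩, hy⟩)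
  let I : Ideal R := Ideal.span ((fun y : {y : R // IsNilpotent (x * y)} => y.1) '' (t : Set _))
  have hI : I.FG := Submodule.fg_span (t.finite_toSet.image _)
  obtain ⟨⟨y, hy⟩⟩ := IsBezout.isPrincipal_of_FG I hI
  refine ⟨y, ?_, fun P hP ⟨hxP, hyP⟩ => ?_⟩
  · rw [nilpotent_iff_mem_prime]
    intro Q hQ
    by_cases hxQ : x ∈ Q
    · exact Q.mul_mem_right _ hxQ
    · refine Q.mul_mem_left _ ?_
      have hIQ : I ≤ Q := by
        rw [Ideal.span_le]
        rintro _ ⟨z, -, rfl⟩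
        exact (hQ.mem_or_mem (nilpotent_iff_mem_prime.1 z.2 Q hQ)).resolve_left hxQ
      exact hIQ (hy ▸ Ideal.mem_span_singleton_self y)
  · obtain ⟨z, hz, hzP⟩ := Set.mem_iUnion₂.1 (ht (a := ⟨⟨P, hP.1.1⟩, hP⟩) hxP)
    refine hzP ?_
    have hzI : z.1 ∈ I := Ideal.subset_span ⟨z, hz, rfl⟩
    rw [hy] at hzI
    obtain ⟨r, hr⟩ := Ideal.mem_span_singleton'.1 hzI
    exact hr ▸ P.mul_mem_left r hyP

/-- Every element of a Bézout ring with compact minimal spectrum has a support idempotent, up to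
nilpotents. -/
theorem exists_support_idempotent {R : Type u} [CommRing R] [IsBezout R]
    [CompactSpace (MinSpec R)] (x : R) :
    ∃ f, f * f = f ∧ IsNilpotent (x * (1 - f)) ∧ ∀ P ∈ minimalPrimes R, x + (1 - f) ∉ P := by
  obtain ⟨y, hxy, hmin⟩ := exists_isNilpotent_mul_forall_minimalPrimes x
  have hxy := nilpotent_iff_mem_prime.1 hxy
  obtain ⟨x', hx'⟩ := IsBezout.gcd_dvd_left x y
  obtain ⟨y', hy'⟩ := IsBezout.gcd_dvd_right x y
  obtain ⟨s, t, hst⟩ := IsBezout.gcd_eq_sum x y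
  set d := IsBezout.gcd x y
  have hd : ∀ P ∈ minimalPrimes R, d ∉ P := fun P hP hdP =>
    hmin P hP ⟨hx' ▸ P.mul_mem_right _ hdP, hy' ▸ P.mul_mem_right _ hdP⟩
  have hnil : IsNilpotent (x' * y') := by
    rw [nilpotent_iff_mem_prime]
    intro Q hQ
    obtain ⟨P, hP, hPQ⟩ := Ideal.exists_minimalPrimes_le (bot_le : ⊥ ≤ Q)
    have h : d * (d * (x' * y')) ∈ P := by
      have := hxy P hP.1.1
      rwa [hx', hy', show d * x' * (d * y') = d * (d * (x' * y')) by ring] at this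
    have hPp := hP.1.1
    exact hPQ <| ((hPp.mem_or_mem ((hPp.mem_or_mem h).resolve_left (hd P hP))).resolve_left
      (hd P hP))
  have hcop : IsCoprime x' y' := by
    rw [← Ideal.isCoprime_span_singleton_iff, Ideal.isCoprime_iff_sup_eq]
    by_contra hne
    obtain ⟨Q, hQ, hle⟩ := Ideal.exists_le_maximal _ hne
    have hx'Q : x' ∈ Q := hle (Ideal.mem_sup_left (Ideal.mem_span_singleton_self x'))
    have hy'Q : y' ∈ Q := hle (Ideal.mem_sup_right (Ideal.mem_span_singleton_self y'))
    have := hQ.isPrime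
    obtain ⟨P, hP, hPQ⟩ := Ideal.exists_minimalPrimes_le (bot_le : ⊥ ≤ Q)
    have h : d * (s * x' + t * y' - 1) ∈ P := by
      have : d * (s * x' + t * y' - 1) = 0 := by linear_combination hst - s * hx' - t * hy'
      rw [this]; exact P.zero_mem
    have h1 := hPQ ((hP.1.1.mem_or_mem h).resolve_left (hd P hP))
    refine hQ.ne_top ((Ideal.eq_top_iff_one Q).2 ?_)
    have := Q.sub_mem (Q.add_mem (Q.mul_mem_left s hx'Q) (Q.mul_mem_left t hy'Q)) h1
    simpa using this
  obtain ⟨N, hN⟩ := hnil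
  obtain ⟨α, β, hαβ⟩ := hcop.pow (m := N + 1) (n := N + 1)
  have hf : 1 - α * x' ^ (N + 1) = β * y' ^ (N + 1) := by linear_combination -hαβ
  refine ⟨α * x' ^ (N + 1), ?_, ⟨N, ?_⟩, fun P hP hmem => ?_⟩
  · have h0 : (x' * y') ^ (N + 1) = 0 := by rw [pow_succ, hN, zero_mul]
    rw [mul_pow] at h0
    linear_combination (-α * x' ^ (N + 1)) * hf - α * β * h0
  · rw [hf, hx', show d * x' * (β * y' ^ (N + 1)) = (x' * y') * (d * β * y' ^ N) by ring, mul_pow,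
      hN, zero_mul]
  · have hPp := hP.1.1
    have hx'y' : x' * y' ∈ P := hPp.mem_of_pow_mem N (hN ▸ P.zero_mem)
    rcases hPp.mem_or_mem hx'y' with h | h
    · have hxP : x ∈ P := hx' ▸ P.mul_mem_left _ h
      have h1 := (P.add_mem_iff_right hxP).1 hmem
      refine hPp.ne_top ((Ideal.eq_top_iff_one P).2 ?_)
      have := P.add_mem h1 (P.mul_mem_left α (P.pow_mem_of_mem h (N + 1) N.succ_pos))
      simpa using this
    · rw [hf] at hmem
      exact hmin P hP ⟨(P.add_mem_iff_left
        (P.mul_mem_left β (P.pow_mem_of_mem h (N + 1) N.succ_pos))).1 hmem, hy' ▸ P.mul_mem_left _ h⟩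

/-- In a ring of dimension at most one, elements avoiding every minimal prime have zero-dimensional
quotients, so every element is strongly `π`-regular modulo them. -/
theorem exists_pow_mul_one_sub_mem_span {R : Type u} [CommRing R]
    (hdim : ∀ P Q T : Ideal R, P.IsPrime → Q.IsPrime → T.IsPrime → P < Q → ¬ Q < T)
    {u : R} (hu : ∀ P ∈ minimalPrimes R, u ∉ P) (b : R) :
    ∃ (n : ℕ) (r : R), b ^ n * (1 - b * r) ∈ Ideal.span {u} := by
  by_contra! h
  let S : Submonoid R :=
    { carrier := {z | ∃ (n : ℕ) (r : R), z = b ^ n * (1 - b * r)}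
      one_mem' := ⟨0, 0, by simp⟩
      mul_mem' := by
        rintro _ _ ⟨n, r, rfl⟩ ⟨m, r', rfl⟩
        exact ⟨n + m, r + r' - b * r * r', by ring⟩ }
  obtain ⟨P, hP, huP, hPS⟩ := Ideal.exists_le_prime_disjoint (Ideal.span {u}) S (by
    rw [Set.disjoint_left]
    rintro z hz ⟨n, r, rfl⟩
    exact h n r hz)
  have hPmax : P.IsMaximal := by
    obtain ⟨M, hM, hPM⟩ := Ideal.exists_le_maximal P hP.ne_top
    obtain ⟨P₀, hP₀, hle⟩ := Ideal.exists_minimalPrimes_le (bot_le : ⊥ ≤ P)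
    have huP : u ∈ P := huP (Ideal.mem_span_singleton_self u)
    have hlt : P₀ < P := lt_of_le_of_ne hle fun he => hu P₀ hP₀ (he ▸ huP)
    have := hdim P₀ P M hP₀.1.1 hP hM.isPrime hlt
    rwa [eq_of_le_of_not_lt hPM this]
  have hb : b ∉ P := fun hb => Set.disjoint_left.1 hPS hb ⟨1, 0, by simp⟩
  obtain ⟨r, p, hp, hr⟩ := hPmax.exists_inv hb
  exact Set.disjoint_left.1 hPS hp ⟨0, r, by linear_combination hr⟩

/-- In a Bézout ring of dimension at most one with compact minimal spectrum, the quotient by `c`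
has stable range one on the support of `c`. -/
theorem exists_idempotent_stable_range {R : Type u} [CommRing R] [IsBezout R]
    (hdim : ∀ P Q T : Ideal R, P.IsPrime → Q.IsPrime → T.IsPrime → P < Q → ¬ Q < T)
    [CompactSpace (MinSpec R)] (b c : R) :
    ∃ f t, f * f = f ∧ IsNilpotent (c * (1 - f)) ∧
      ∀ Q : Ideal R, Q.IsPrime → c ∈ Q → 1 - f ∈ Q → ∀ a, b + t * a ∈ Q → a ∈ Q ∧ b ∈ Q := by
  obtain ⟨f, hf, hcf, hmin⟩ := exists_support_idempotent c
  obtain ⟨n, r, hr⟩ := exists_pow_mul_one_sub_mem_span hdim hmin b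
  refine ⟨f, 1 - b * r, hf, hcf, fun Q hQ hc h1f a ha => ?_⟩
  have hmem : b ^ n * (1 - b * r) ∈ Q :=
    (Ideal.span_singleton_le_iff_mem Q).2 (Q.add_mem hc h1f) hr
  have hb : b ∈ Q := by
    rcases hQ.mem_or_mem hmem with h | h
    · exact hQ.mem_of_pow_mem n h
    · exact (Q.add_mem_iff_left (Q.mul_mem_right a h)).1 ha
  refine ⟨?_, hb⟩
  have h2 := (Q.add_mem_iff_right hb).1 ha
  have := Q.add_mem h2 (Q.mul_mem_right (r * a) hb)
  convert this using 1
  ring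

/-- A Bézout ring of dimension at most one with compact minimal spectrum is Hermite. -/
theorem isHermiteRing_of_isBezout_of_krullDimLEOne {R : Type u} [CommRing R] [IsBezout R]
    (hdim : ∀ P Q T : Ideal R, P.IsPrime → Q.IsPrime → T.IsPrime → P < Q → ¬ Q < T)
    [CompactSpace (MinSpec R)] : IsHermiteRing R := by
  intro a b
  obtain ⟨a₁, ha₁⟩ := IsBezout.gcd_dvd_left a b
  obtain ⟨b₁, hb₁⟩ := IsBezout.gcd_dvd_right a b
  obtain ⟨s, t, hst⟩ := IsBezout.gcd_eq_sum a b
  set d := IsBezout.gcd a b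
  obtain ⟨x, hx⟩ : ∃ x, x = 1 - s * a₁ - t * b₁ := ⟨_, rfl⟩
  have hdx : d * x = 0 := by linear_combination d * hx - hst + s * ha₁ + t * hb₁
  obtain ⟨f, τ, hf, hxf, hQ⟩ := exists_idempotent_stable_range hdim a₁ x
  have hcop : ∀ Q : Ideal R, Q.IsPrime → a₁ ∈ Q → b₁ ∈ Q → x ∉ Q := fun Q hQ ha hb hx' => by
    refine hQ.ne_top ((Ideal.eq_top_iff_one Q).2 ?_)
    rw [show (1 : R) = x + s * a₁ + t * b₁ by rw [hx]; ring]
    exact Q.add_mem (Q.add_mem hx' (Q.mul_mem_left _ ha)) (Q.mul_mem_left _ hb)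
  have htop : Ideal.span {a₁ + τ * b₁, x, 1 - f} = ⊤ := by
    by_contra hne
    obtain ⟨Q, hQm, hle⟩ := Ideal.exists_le_maximal _ hne
    have hxQ : x ∈ Q := hle (Ideal.subset_span (by simp))
    obtain ⟨h1, h2⟩ := hQ Q hQm.isPrime hxQ (hle (Ideal.subset_span (by simp))) b₁
      (hle (Ideal.subset_span (by simp)))
    exact hcop Q hQm.isPrime h2 h1 hxQ
  obtain ⟨w, r, σ, hw⟩ := Submodule.mem_span_triple.1 ((Ideal.eq_top_iff_one _).1 htop)
  simp only [smul_eq_mul] at hw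
  refine ⟨d, a₁ - τ * (f * r * (1 - b₁)) * x, b₁ + f * r * (1 - b₁) * x, ?_, ?_, ?_⟩
  · linear_combination ha₁ + τ * (f * r * (1 - b₁)) * hdx
  · linear_combination hb₁ - f * r * (1 - b₁) * hdx
  · by_contra hne
    obtain ⟨Q, hQm, hle⟩ := Ideal.exists_le_maximal _ hne
    have hQp := hQm.isPrime
    have h1 := hle (Ideal.mem_sup_left (Ideal.mem_span_singleton_self _))
    have h2 := hle (Ideal.mem_sup_right (Ideal.mem_span_singleton_self _))
    rcases hQp.mem_or_mem (show f * (1 - f) ∈ Q by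
      rw [show f * (1 - f) = 0 by linear_combination -hf]; exact Q.zero_mem) with hfQ | hfQ
    · have hb : b₁ ∈ Q := by
        rw [show b₁ = b₁ + f * r * (1 - b₁) * x - f * (r * (1 - b₁) * x) by ring]
        exact Q.sub_mem h2 (Q.mul_mem_right _ hfQ)
      have ha : a₁ ∈ Q := by
        rw [show a₁ = a₁ - τ * (f * r * (1 - b₁)) * x + f * (τ * r * (1 - b₁) * x) by ring]
        exact Q.add_mem h1 (Q.mul_mem_right _ hfQ)
      refine hcop Q hQp ha hb ?_
      rw [show x = x * (1 - f) + f * x by ring]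
      exact Q.add_mem (nilpotent_iff_mem_prime.1 hxf Q hQp) (Q.mul_mem_right _ hfQ)
    · have hv : a₁ + τ * b₁ ∈ Q := by
        have := Q.add_mem h1 (Q.mul_mem_left τ h2)
        convert this using 1
        ring
      refine hQp.ne_top ((Ideal.eq_top_iff_one Q).2 ?_)
      have h3 : b₁ + f * (1 - b₁) * (1 - w * (a₁ + τ * b₁) - σ * (1 - f)) ∈ Q := by
        convert h2 using 1
        linear_combination -f * (1 - b₁) * hw
      have : (1 : R) = (b₁ + f * (1 - b₁) * (1 - w * (a₁ + τ * b₁) - σ * (1 - f)))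
          + (f * (1 - b₁) * w) * (a₁ + τ * b₁) + (f * (1 - b₁) * σ + (1 - b₁)) * (1 - f) := by ring
      rw [this]
      exact Q.add_mem (Q.add_mem h3 (Q.mul_mem_left _ hv)) (Q.mul_mem_left _ hfQ)

/-- Over a Hermite ring every linear form on a nonzero finite free module is a multiple of a
coordinate of a suitable basis. -/
theorem IsHermiteRing.exists_linearEquiv_eq_mul_fst {R : Type u} [CommRing R]
    (h : IsHermiteRing R) (n : ℕ) (φ : (Fin (n + 1) → R) →ₗ[R] R) :
    ∃ (d : R) (e : (Fin (n + 1) → R) ≃ₗ[R] R × (Fin n → R)), ∀ x, φ x = d * (e x).1 := by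
  induction n with
  | zero =>
    refine ⟨φ (Pi.single 0 1), (Fin.consLinearEquiv R fun _ => R).symm, fun x => ?_⟩
    have hx : x = x 0 • Pi.single 0 1 := by
      ext i
      simp [Fin.fin_one_eq_zero i]
    conv_lhs => rw [hx]
    rw [map_smul, smul_eq_mul, mul_comm]
    rfl
  | succ n ih =>
    let c := Fin.consLinearEquiv R fun _ : Fin (n + 2) => R
    obtain ⟨d₀, e₀, he₀⟩ := ih (φ ∘ₗ c.toLinearMap ∘ₗ LinearMap.inr R R _)
    obtain ⟨d, a, b, ha, hb, hab⟩ := h (φ (c (1, 0))) d₀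
    rw [← Ideal.one_eq_top, ← Ideal.isCoprime_iff_add, Ideal.isCoprime_span_singleton_iff] at hab
    obtain ⟨s, t, hst⟩ := hab
    let g : (R × R × (Fin n → R)) ≃ₗ[R] R × R × (Fin n → R) :=
      { toFun := fun x => (a * x.1 + b * x.2.1, s * x.2.1 - t * x.1, x.2.2)
        invFun := fun x => (s * x.1 - b * x.2.1, t * x.1 + a * x.2.1, x.2.2)
        map_add' := fun x y => by
          ext <;> simp <;> ring
        map_smul' := fun r x => by
          ext <;> simp <;> ring
        left_inv := fun x => by
          refine Prod.ext ?_ (Prod.ext ?_ rfl)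
          · linear_combination x.1 * hst
          · linear_combination x.2.1 * hst
        right_inv := fun x => by
          refine Prod.ext ?_ (Prod.ext ?_ rfl)
          · linear_combination x.1 * hst
          · linear_combination x.2.1 * hst }
    refine ⟨d, c.symm ≪≫ₗ ((LinearEquiv.refl R R).prodCongr e₀) ≪≫ₗ g ≪≫ₗ
      ((LinearEquiv.refl R R).prodCongr (Fin.consLinearEquiv R fun _ : Fin (n + 1) => R)),
      fun x => ?_⟩
    obtain ⟨⟨y, z⟩, rfl⟩ := c.surjective x
    have h1 : φ (c (y, z)) = y * φ (c (1, 0)) + φ (c (0, z)) := by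
      rw [← smul_eq_mul, ← map_smul, ← map_smul, ← map_add, ← map_add]
      simp
    have h2 : φ (c (0, z)) = d₀ * (e₀ z).1 := he₀ z
    rw [h1, h2]
    simp only [LinearEquiv.trans_apply, LinearEquiv.symm_apply_apply, LinearEquiv.prodCongr_apply,
      LinearEquiv.refl_apply]
    change _ = d * (a * y + b * (e₀ z).1)
    linear_combination y * ha + (e₀ z).1 * hb

/-- Over a Hermite ring every surjective linear form on a finite free module is a coordinate of a
suitable basis, whose first vector may be any prescribed vector with value one. -/
theorem IsHermiteRing.exists_linearEquiv_fst_eq {R : Type u} [CommRing R]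
    (h : IsHermiteRing R) {n : ℕ} {φ : (Fin (n + 1) → R) →ₗ[R] R} {q : Fin (n + 1) → R}
    (hq : φ q = 1) :
    ∃ e : (Fin (n + 1) → R) ≃ₗ[R] R × (Fin n → R), (∀ x, (e x).1 = φ x) ∧ e q = (1, 0) := by
  obtain ⟨d, e, he⟩ := h.exists_linearEquiv_eq_mul_fst n φ
  obtain ⟨u, rfl⟩ : IsUnit d := IsUnit.of_mul_eq_one _ ((he q).symm.trans hq)
  let e' := e ≪≫ₗ LinearEquiv.smulOfUnit u
  have he' (x) : (e' x).1 = φ x := (he x).symm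
  refine ⟨e' ≪≫ₗ LinearEquiv.skewProd (LinearEquiv.refl R R) (LinearEquiv.refl R _)
    (-(LinearMap.toSpanSingleton R _ (e' q).2)), he', ?_⟩
  rw [LinearEquiv.trans_apply, LinearEquiv.skewProd_apply, he', hq]
  simp

/-- Two linear forms with comaximal ranges have a surjective linear combination. -/
theorem exists_surjective_combination_pair {R : Type u} [CommRing R] [IsBezout R]
    (hdim : ∀ P Q T : Ideal R, P.IsPrime → Q.IsPrime → T.IsPrime → P < Q → ¬ Q < T)
    [CompactSpace (MinSpec R)] {n : ℕ} (φ₁ φ₂ : (Fin (n + 1) → R) →ₗ[R] R)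
    (hφ : LinearMap.range φ₁ ⊔ LinearMap.range φ₂ = ⊤) :
    ∃ p₁ p₂ : R, Function.Surjective (p₁ • φ₁ + p₂ • φ₂) := by
  obtain ⟨c, e, he⟩ :=
    (isHermiteRing_of_isBezout_of_krullDimLEOne hdim).exists_linearEquiv_eq_mul_fst n φ₂
  let ψ : (Fin n → R) →ₗ[R] R := φ₁ ∘ₗ e.symm.toLinearMap ∘ₗ LinearMap.inr R R _
  obtain ⟨⟨a, ha⟩⟩ := IsBezout.isPrincipal_of_FG (LinearMap.range ψ) (by
    rw [LinearMap.range_eq_map]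
    exact Module.Finite.fg_top.map ψ)
  obtain ⟨z, hz⟩ : a ∈ LinearMap.range ψ := ha ▸ Submodule.mem_span_singleton_self a
  obtain ⟨b, hb⟩ : ∃ b, b = φ₁ (e.symm (1, 0)) := ⟨_, rfl⟩
  have hφ₁ (x) : ∃ r, φ₁ x = (e x).1 * b + r * a := by
    obtain ⟨r, hr⟩ := Submodule.mem_span_singleton.1 (ha ▸ LinearMap.mem_range_self ψ (e x).2)
    refine ⟨r, ?_⟩
    rw [← smul_eq_mul r, hr, hb, ← smul_eq_mul, ← map_smul, ← map_smul]
    change _ = _ + φ₁ (e.symm (0, (e x).2))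
    rw [← map_add, ← map_add]
    simp
  obtain ⟨f, t, hf, hcf, hQ⟩ := exists_idempotent_stable_range hdim b c
  have hcop : ∀ Q : Ideal R, Q.IsPrime → a ∈ Q → b ∈ Q → c ∉ Q := fun Q hQ haQ hbQ hcQ => by
    refine hQ.ne_top (top_le_iff.1 (hφ ▸ sup_le ?_ ?_))
    · rintro _ ⟨x, rfl⟩
      obtain ⟨r, hr⟩ := hφ₁ x
      exact hr ▸ Q.add_mem (Q.mul_mem_left _ hbQ) (Q.mul_mem_left _ haQ)
    · rintro _ ⟨x, rfl⟩
      exact he x ▸ Q.mul_mem_right _ hcQ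
  have htop : Ideal.span {b + t * a, c, 1 - f} = ⊤ := by
    by_contra hne
    obtain ⟨Q, hQm, hle⟩ := Ideal.exists_le_maximal _ hne
    have hcQ : c ∈ Q := hle (Ideal.subset_span (by simp))
    obtain ⟨h1, h2⟩ := hQ Q hQm.isPrime hcQ (hle (Ideal.subset_span (by simp))) a
      (hle (Ideal.subset_span (by simp)))
    exact hcop Q hQm.isPrime h1 h2 hcQ
  obtain ⟨p₁, p₂, σ, hp⟩ := Submodule.mem_span_triple.1 ((Ideal.eq_top_iff_one _).1 htop)
  simp only [smul_eq_mul] at hp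
  refine ⟨f * p₁ + (1 - f), f * p₂, LinearMap.range_eq_top.1 ?_⟩
  by_contra hne
  obtain ⟨Q, hQm, hle⟩ := Ideal.exists_le_maximal _ hne
  have hQp := hQm.isPrime
  have hmem (x) : (f * p₁ + (1 - f)) * φ₁ x + f * p₂ * φ₂ x ∈ Q := hle ⟨x, rfl⟩
  rcases hQp.mem_or_mem (show f * (1 - f) ∈ Q by
    rw [show f * (1 - f) = 0 by linear_combination -hf]; exact Q.zero_mem) with hfQ | hfQ
  · have h1 (x) : φ₁ x ∈ Q := by
      have := Q.sub_mem (hmem x) (Q.mul_mem_right ((p₁ - 1) * φ₁ x + p₂ * φ₂ x) hfQ)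
      convert this using 1
      ring
    refine hcop Q hQp (hz ▸ h1 _) (hb ▸ h1 _) ?_
    rw [show c = c * (1 - f) + f * c by ring]
    exact Q.add_mem (nilpotent_iff_mem_prime.1 hcf Q hQp) (Q.mul_mem_right _ hfQ)
  · have h1 : φ₁ (e.symm (1, t • z)) = b + t * a := by
      have : ((1 : R), t • z) = (1, 0) + t • (0, z) := by simp
      rw [this, map_add, map_add, map_smul, map_smul, ← hb, ← hz]
      rfl
    have h2 : φ₂ (e.symm (1, t • z)) = c := by simp [he]
    have h3 := hmem (e.symm (1, t • z))
    rw [h1, h2] at h3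
    refine hQp.ne_top ((Ideal.eq_top_iff_one Q).2 ?_)
    have h4 := Q.add_mem h3 (Q.mul_mem_right (f * σ + 1 - (b + t * a)) hfQ)
    convert h4 using 1
    linear_combination -f * hp

/-- A finite family of linear forms has a common divisor such that the quotients have a surjective
linear combination. -/
theorem exists_common_divisor_surjective_combination {R : Type u} [CommRing R] [IsBezout R]
    (hdim : ∀ P Q T : Ideal R, P.IsPrime → Q.IsPrime → T.IsPrime → P < Q → ¬ Q < T)
    [CompactSpace (MinSpec R)] {n : ℕ} (m : ℕ) (φ : Fin (m + 1) → (Fin (n + 1) → R) →ₗ[R] R) :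
    ∃ (d : R) (φ' : Fin (m + 1) → (Fin (n + 1) → R) →ₗ[R] R) (p : Fin (m + 1) → R),
      (∀ i, φ i = d • φ' i) ∧ Function.Surjective ⇑(∑ i, p i • φ' i) := by
  have hR := isHermiteRing_of_isBezout_of_krullDimLEOne hdim
  have hsingle (ψ : (Fin (n + 1) → R) →ₗ[R] R) :
      ∃ (d : R) (ψ' : (Fin (n + 1) → R) →ₗ[R] R), ψ = d • ψ' ∧ Function.Surjective ψ' := by
    obtain ⟨d, e, he⟩ := hR.exists_linearEquiv_eq_mul_fst n ψ
    exact ⟨d, LinearMap.fst R R (Fin n → R) ∘ₗ e.toLinearMap, LinearMap.ext he,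
      Prod.fst_surjective.comp e.surjective⟩
  induction m with
  | zero =>
    obtain ⟨d, ψ', h, hs⟩ := hsingle (φ 0)
    refine ⟨d, fun _ => ψ', fun _ => 1, fun i => by rw [Fin.fin_one_eq_zero i, h],
      by simpa using hs⟩
  | succ m ih =>
    obtain ⟨c₀, ψ, hψ, hψs⟩ := hsingle (φ 0)
    obtain ⟨d₀, φ', p, hφ', hs⟩ := ih fun i => φ i.succ
    obtain ⟨d, c, d', hc, hd', htop⟩ := hR c₀ d₀
    obtain ⟨p₁, p₂, hp⟩ := exists_surjective_combination_pair hdim (c • ψ)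
      (d' • ∑ i, p i • φ' i) (by
        refine top_le_iff.1 (htop ▸ sup_le_sup ?_ ?_)
        · rw [Ideal.span_singleton_le_iff_mem]
          obtain ⟨x, hx⟩ := hψs 1
          exact ⟨x, by simp [hx]⟩
        · rw [Ideal.span_singleton_le_iff_mem]
          obtain ⟨x, hx⟩ := hs 1
          exact ⟨x, by rw [LinearMap.smul_apply, hx, smul_eq_mul, mul_one]⟩)
    refine ⟨d, Fin.cons (c • ψ) fun i => d' • φ' i, Fin.cons p₁ fun i => p₂ * p i,
      fun i => ?_, ?_⟩
    · induction i using Fin.cases with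
      | zero => rw [Fin.cons_zero, smul_smul, ← hc, hψ]
      | succ i => rw [Fin.cons_succ, smul_smul, ← hd', hφ']
    · convert hp using 2
      rw [Fin.sum_univ_succ]
      simp only [Fin.cons_zero, Fin.cons_succ, Finset.smul_sum, smul_smul]
      simp only [mul_comm, mul_left_comm]

/-- A map of finite free modules splits off a rank one summand after extraction of a common
divisor. -/
theorem exists_linearEquiv_prod_smul {R : Type u} [CommRing R] [IsBezout R]
    (hdim : ∀ P Q T : Ideal R, P.IsPrime → Q.IsPrime → T.IsPrime → P < Q → ¬ Q < T)
    [CompactSpace (MinSpec R)] {m n : ℕ} (A : (Fin (n + 1) → R) →ₗ[R] (Fin (m + 1) → R)) :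
    ∃ (d : R) (e₁ : (Fin (n + 1) → R) ≃ₗ[R] R × (Fin n → R))
      (e₂ : (Fin (m + 1) → R) ≃ₗ[R] R × (Fin m → R)) (B : (Fin n → R) →ₗ[R] (Fin m → R)),
      ∀ x, e₂ (A (e₁.symm x)) = (d * x.1, B x.2) := by
  have hR := isHermiteRing_of_isBezout_of_krullDimLEOne hdim
  obtain ⟨d, φ', p, hφ', hs⟩ :=
    exists_common_divisor_surjective_combination hdim m fun i => LinearMap.proj i ∘ₗ A
  obtain ⟨q, hq⟩ := hs 1
  let A' := LinearMap.pi φ'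
  have hA (x) : A x = d • A' x := funext fun i => LinearMap.congr_fun (hφ' i) x
  let π : (Fin (m + 1) → R) →ₗ[R] R := ∑ i, p i • LinearMap.proj i
  have hπ (x) : π (A' x) = (∑ i, p i • φ' i) x := by simp [π, A']
  obtain ⟨e₁, he₁, he₁q⟩ := hR.exists_linearEquiv_fst_eq hq
  obtain ⟨e₂, he₂, he₂q⟩ := hR.exists_linearEquiv_fst_eq ((hπ q).trans hq)
  refine ⟨d, e₁, e₂, d • (LinearMap.snd R R _ ∘ₗ e₂.toLinearMap ∘ₗ A' ∘ₗ e₁.symm.toLinearMap ∘ₗ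
    LinearMap.inr R R _), fun ⟨a, z⟩ => ?_⟩
  have hfst : (e₂ (A' (e₁.symm (a, z)))).1 = a := by
    rw [he₂, hπ, ← he₁, LinearEquiv.apply_symm_apply]
  have hsnd : (e₂ (A' (e₁.symm (a, z)))).2 = (e₂ (A' (e₁.symm (0, z)))).2 := by
    have h1 : e₁.symm (a, z) = a • q + e₁.symm (0, z) := by
      rw [LinearEquiv.symm_apply_eq, map_add, map_smul, he₁q]
      simp
    rw [h1, map_add, map_add, map_smul, map_smul, he₂q]
    simp
  rw [hA, map_smul]
  refine Prod.ext ?_ ?_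
  · rw [Prod.smul_fst, hfst, smul_eq_mul]
  · rw [Prod.smul_snd, hsnd]
    rfl

/-- Over a Bézout ring of dimension at most one with compact minimal spectrum, maps of finite free
modules are diagonalizable. -/
theorem exists_linearEquiv_diagonal {R : Type u} [CommRing R] [IsBezout R]
    (hdim : ∀ P Q T : Ideal R, P.IsPrime → Q.IsPrime → T.IsPrime → P < Q → ¬ Q < T)
    [CompactSpace (MinSpec R)] (m n : ℕ) (A : (Fin n → R) →ₗ[R] (Fin m → R)) :
    ∃ (e₂ : (Fin m → R) ≃ₗ[R] (Fin m → R)) (e₁ : (Fin n → R) ≃ₗ[R] (Fin n → R)),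
      ∀ (i : Fin m) (j : Fin n), (i : ℕ) ≠ j → e₂ (A (e₁ (Pi.single j 1))) i = 0 := by
  induction m generalizing n with
  | zero => exact ⟨.refl R _, .refl R _, fun i => i.elim0⟩
  | succ m ih =>
    cases n with
    | zero => exact ⟨.refl R _, .refl R _, fun _ j => j.elim0⟩
    | succ n =>
      obtain ⟨d, e₁, e₂, B, hB⟩ := exists_linearEquiv_prod_smul hdim A
      obtain ⟨f₂, f₁, hf⟩ := ih n B
      let c (k : ℕ) := Fin.consLinearEquiv R fun _ : Fin (k + 1) => R
      refine ⟨e₂ ≪≫ₗ (LinearEquiv.refl R R).prodCongr f₂ ≪≫ₗ c m,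
        (c n).symm ≪≫ₗ (LinearEquiv.refl R R).prodCongr f₁ ≪≫ₗ e₁.symm, fun i j hij => ?_⟩
      simp only [LinearEquiv.trans_apply, hB]
      have hc0 : (c n).symm (Pi.single 0 1) = (1, 0) := by
        rw [LinearEquiv.symm_apply_eq]
        ext k
        refine Fin.cases ?_ (fun k => ?_) k <;> simp [c]
      have hcs (k : Fin n) : (c n).symm (Pi.single k.succ 1) = (0, Pi.single k 1) := by
        rw [LinearEquiv.symm_apply_eq]
        ext l
        refine Fin.cases ?_ (fun l => ?_) l <;> simp [c, Pi.single_apply]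
      induction j using Fin.cases with
      | zero =>
        induction i using Fin.cases with
        | zero => exact absurd rfl hij
        | succ i => simp [hc0, c]
      | succ j =>
        induction i using Fin.cases with
        | zero => simp [hcs, c]
        | succ i =>
          have := hf i j fun h => hij (by simp [h])
          simpa [hcs, c] using this

/-- A commutative Bézout ring of Krull dimension at most one with compact
minimal prime spectrum is a Kaplansky ring. -/
theorem isKaplanskyRing_of_isBezout_of_krullDimLEOne (R : Type u) [CommRing R]
    [IsBezout R]
    (hdim : ∀ P Q T : Ideal R, P.IsPrime → Q.IsPrime → T.IsPrime → P < Q → ¬ Q < T)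
    (hmin : CompactSpace (MinSpec R)) : IsKaplanskyRing R := by
  intro m n A
  obtain ⟨e₂, e₁, h⟩ := exists_linearEquiv_diagonal hdim m n A.toLin'
  refine ⟨LinearMap.toMatrix' e₂.toLinearMap, LinearMap.toMatrix' e₁.toLinearMap,
    LinearMap.isUnit_toMatrix'_iff.2 ((Module.End.isUnit_iff _).2 e₂.bijective),
    LinearMap.isUnit_toMatrix'_iff.2 ((Module.End.isUnit_iff _).2 e₁.bijective), fun i j hij => ?_⟩
  have hA : LinearMap.toMatrix' e₂.toLinearMap * A * LinearMap.toMatrix' e₁.toLinearMap =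
      LinearMap.toMatrix' (e₂.toLinearMap ∘ₗ A.toLin' ∘ₗ e₁.toLinearMap) := by
    rw [LinearMap.toMatrix'_comp, LinearMap.toMatrix'_comp, LinearMap.toMatrix'_toLin', Matrix.mul_assoc]
  rw [hA, LinearMap.toMatrix'_apply]
  exact h i j hij
end

section
/- Every commutative fractionally self fp-injective ring that is a Bézout ring is a Kaplansky ring. -/
open DirectSum

universe u

open CategoryTheory in
/-- A self fp-injective ring satisfies the double annihilator condition on principal ideals. -/
theorem SelfFPInjective.dvd_of_annihilator_le {S : Type u} [CommRing S] (hS : SelfFPInjective S)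
    {s x : S} (hx : ∀ r, s * r = 0 → x * r = 0) : s ∣ x := by
  let f : S →ₗ[S] S := LinearMap.mulLeft S s
  let φ : LinearMap.range f →ₗ[S] S :=
    (LinearMap.ker f).liftQ (LinearMap.mulLeft S x) (fun r hr => hx r hr) ∘ₗ
      f.quotKerEquivRange.symm.toLinearMap
  have hφ (r : S) (h : f r ∈ LinearMap.range f) : φ ⟨f r, h⟩ = x * r := by
    have : f.quotKerEquivRange.symm ⟨f r, h⟩ = (LinearMap.ker f).mkQ r :=
      f.quotKerEquivRange_symm_apply_image r h
    rw [LinearMap.comp_apply, LinearEquiv.coe_coe, this]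
    rfl
  let F : ModuleCat.{u} S := ModuleCat.of S (S ⧸ LinearMap.range f)
  have hF : Module.FinitePresentation S F :=
    Module.finitePresentation_of_surjective (LinearMap.range f).mkQ
      (Submodule.mkQ_surjective _) (by
        rw [Submodule.ker_mkQ, LinearMap.range_eq_map]
        exact (Module.Finite.fg_top (R := S) (M := S)).map f)
  let P := projectiveResolution F
  have hsub := hS F hF
  have hex : (P.complex.linearYonedaObj S (ModuleCat.of S S)).ExactAt 1 := by
    rw [HomologicalComplex.exactAt_iff_isZero_homology]
    exact (ModuleCat.isZero_of_subsingleton _).of_iso (P.isoExt (R := S) 1 (ModuleCat.of S S)).symm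
  rw [HomologicalComplex.exactAt_iff' _ 0 1 2 (by simp) (by simp),
    ShortComplex.moduleCat_exact_iff] at hex
  let π : P.complex.X 0 ⟶ F := P.π.f 0
  have hπ : Function.Surjective π := by
    rw [← ModuleCat.epi_iff_surjective]
    exact inferInstanceAs (Epi (P.π.f 0))
  let q : ModuleCat.of S S ⟶ F := ModuleCat.ofHom (LinearMap.range f).mkQ
  have : Epi q := (ModuleCat.epi_iff_surjective _).2 (Submodule.mkQ_surjective _)
  let ρ : P.complex.X 0 ⟶ ModuleCat.of S S := Projective.factorThru π q
  have hρ : ρ ≫ q = π := Projective.factorThru_comp _ _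
  have hρ' (p : P.complex.X 0) : (LinearMap.range f).mkQ (ρ.hom p) = π.hom p := by
    rw [← hρ]; rfl
  have hd (w : P.complex.X 1) : π.hom ((P.complex.d 1 0).hom w) = 0 := by
    have := P.complex_d_comp_π_f_zero
    exact LinearMap.congr_fun (congrArg ModuleCat.Hom.hom this) w
  have hdd (w : P.complex.X 2) : (P.complex.d 1 0).hom ((P.complex.d 2 1).hom w) = 0 :=
    LinearMap.congr_fun (congrArg ModuleCat.Hom.hom (P.complex.d_comp_d 2 1 0)) w
  let σ : P.complex.X 1 →ₗ[S] LinearMap.range f :=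
    (ρ.hom ∘ₗ (P.complex.d 1 0).hom).codRestrict _ fun w => by
      rw [← Submodule.Quotient.mk_eq_zero]
      exact (hρ' _).trans (hd w)
  let c : P.complex.X 1 ⟶ ModuleCat.of S S := ModuleCat.ofHom (φ ∘ₗ σ)
  have hc : P.complex.d 2 1 ≫ c = 0 := by
    ext w
    have : σ ((P.complex.d 2 1).hom w) = 0 := by
      ext
      simp [σ, hdd]
    change φ (σ ((P.complex.d 2 1).hom w)) = 0
    rw [this, map_zero]
  obtain ⟨ψ, hψ⟩ : ∃ ψ : P.complex.X 0 ⟶ ModuleCat.of S S, P.complex.d 1 0 ≫ ψ = c := hex c hc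
  obtain ⟨p, hp⟩ := hπ ((LinearMap.range f).mkQ 1)
  obtain ⟨k, hk⟩ : ∃ k, s * k = ρ.hom p - 1 := by
    have : (LinearMap.range f).mkQ (ρ.hom p - 1) = 0 := by
      rw [map_sub, hρ', sub_eq_zero]
      exact hp
    exact (Submodule.Quotient.mk_eq_zero _).1 this
  have hsp : π.hom (s • p) = 0 := by
    rw [map_smul, show π.hom p = _ from hp, ← map_smul]
    exact (Submodule.Quotient.mk_eq_zero _).2 ⟨1, rfl⟩
  obtain ⟨w, hw⟩ := (ShortComplex.moduleCat_exact_iff _).1 P.exact₀ (s • p) hsp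
  replace hw : (P.complex.d 1 0).hom w = s • p := hw
  have h1 : c.hom w = s * ψ.hom p := by
    rw [← hψ]
    change ψ.hom ((P.complex.d 1 0).hom w) = _
    rw [hw, map_smul, smul_eq_mul]
  have h2 : c.hom w = x * (1 + s * k) := by
    rw [← hφ _ ⟨_, rfl⟩]
    change φ (σ w) = _
    congr 1
    ext
    change ρ.hom ((P.complex.d 1 0).hom w) = s * (1 + s * k)
    rw [hw, map_smul, hk, smul_eq_mul, add_sub_cancel]
  exact ⟨ψ.hom p - x * k, by linear_combination h1 - h2⟩

/-- An ideal with no zero in any residue field is the whole ring. -/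
theorem Ideal.eq_top_of_forall_field {R : Type u} [CommRing R] {I : Ideal R}
    (h : ∀ (K : Type u) [Field K] (φ : R →+* K), (∀ x ∈ I, φ x = 0) → False) : I = ⊤ := by
  by_contra hne
  obtain ⟨M, hM, hle⟩ := Ideal.exists_le_maximal _ hne
  let := Ideal.Quotient.field M
  exact h (R ⧸ M) (Ideal.Quotient.mk M) fun x hx => Ideal.Quotient.eq_zero_iff_mem.2 (hle hx)

/-- Two elements are coprime as soon as they have no common zero in a residue field. -/
theorem isCoprime_of_forall_field {R : Type u} [CommRing R] {a b : R}
    (h : ∀ (K : Type u) [Field K] (φ : R →+* K), φ a = 0 → φ b = 0 → False) : IsCoprime a b := by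
  rw [← Ideal.isCoprime_span_singleton_iff, Ideal.isCoprime_iff_sup_eq]
  exact Ideal.eq_top_of_forall_field fun K _ φ hφ => h K φ
    (hφ _ (Ideal.mem_sup_left (Ideal.mem_span_singleton_self _)))
    (hφ _ (Ideal.mem_sup_right (Ideal.mem_span_singleton_self _)))

/-- In a Bézout ring any two elements are multiples of one of their linear combinations. -/
theorem IsBezout.exists_common_factor {R : Type*} [CommRing R] [IsBezout R] (a b : R) :
    ∃ d a' b' x y : R, a = d * a' ∧ b = d * b' ∧ d = x * a + y * b := by
  obtain ⟨x, y, h⟩ := IsBezout.gcd_eq_sum a b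
  obtain ⟨a', ha⟩ := IsBezout.gcd_dvd_left a b
  obtain ⟨b', hb⟩ := IsBezout.gcd_dvd_right a b
  exact ⟨_, a', b', x, y, ha, hb, h.symm⟩

/-- In a reduced Bézout ring whose total ring of fractions is self fp-injective, every element
differs from a non-zero-divisor by an idempotent annihilating it. -/
theorem exists_idempotent_add_mem_nonZeroDivisors {R : Type u} [CommRing R] [IsBezout R]
    [IsReduced R] (hR : SelfFPInjective (FractionRing R)) (x : R) :
    ∃ e : R, e * e = e ∧ x * e = 0 ∧ ∀ w, (x + e) * w = 0 → w = 0 := by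
  have hinj := IsFractionRing.injective R (FractionRing R)
  have hred : IsReduced (FractionRing R) := inferInstance
  obtain ⟨y, hy⟩ : algebraMap R (FractionRing R) x ^ 2 ∣ algebraMap R (FractionRing R) x :=
    hR.dvd_of_annihilator_le fun r hr => by
      refine eq_zero_of_pow_eq_zero (n := 2) ?_
      linear_combination r * hr
  obtain ⟨z, ⟨s, hs⟩, hzs⟩ := IsLocalization.exists_mk'_eq (nonZeroDivisors R) y
  have hsx : s * x = x * (x * z) := by
    apply hinj
    have := IsLocalization.mk'_spec (FractionRing R) z ⟨s, hs⟩
    rw [hzs] at this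
    simp only [map_mul] at this ⊢
    linear_combination algebraMap R (FractionRing R) s * hy +
      algebraMap R (FractionRing R) x ^ 2 * this
  obtain ⟨d, h, t, α, β, hh, ht, hd⟩ := IsBezout.exists_common_factor (x * z) s
  have hs0 : ∀ {w}, s * w = 0 → w = 0 := fun hw => (mem_nonZeroDivisors_iff.1 hs).1 _ hw
  have hd0 : ∀ {w}, d * w = 0 → w = 0 := fun {w} hw => hs0 (by rw [ht]; linear_combination t * hw)
  have ht0 : ∀ {w}, t * w = 0 → w = 0 := fun {w} hw => hs0 (by rw [ht]; linear_combination d * hw)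
  have h1 : α * h + β * t = 1 := by
    rw [← sub_eq_zero]
    apply hd0
    linear_combination -hd + α * (-hh) - β * ht
  have hht : h * h = t * h := by
    rw [← sub_eq_zero]
    refine hd0 (hd0 ?_)
    have : (x * z) * (x * z) = s * (x * z) := by linear_combination -z * hsx
    rw [hh, ht] at this
    linear_combination this
  have htx : t * x = x * h := by
    rw [← sub_eq_zero]
    apply hd0
    linear_combination hsx - x * ht + x * hh
  have hE : (α + β) * h * h = h := by linear_combination h * h1 + β * hht
  have hxe : x * (1 - (α + β) * h) = 0 := by
    apply ht0
    linear_combination htx + (-x) * hE + (α + β) * x * hht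
  refine ⟨1 - (α + β) * h, by linear_combination (α + β) * hE, hxe, fun w hw => ?_⟩
  have hwe : (1 - (α + β) * h) * w = 0 := by
    linear_combination (1 - (α + β) * h) * hw - w * hxe - w * (α + β) * hE
  have hwx : x * w = 0 := by linear_combination hw - hwe
  have hwh : h * w = 0 := by
    apply hd0
    linear_combination z * hwx - w * hh
  linear_combination hwe + (α + β) * hwh

/-- Over a fractionally self fp-injective Bézout ring, each element `c` is, modulo any radical
ideal `I`, complementary to an idempotent `e`. -/
theorem FractionallySelfFPInjective.exists_idempotent_mod {R : Type u} [CommRing R] [IsBezout R]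
    (hR : FractionallySelfFPInjective R) {I : Ideal R} (hI : I.IsRadical) (c : R) :
    ∃ e : R, e * (1 - e) ∈ I ∧ c * e ∈ I ∧ ∀ w, (c + e) * w ∈ I → w ∈ I := by
  by_cases hT : I = ⊤
  · exact ⟨0, by simp [hT]⟩
  have hred : IsReduced (R ⧸ I) := (Ideal.isRadical_iff_quotient_reduced I).1 hI
  have hbez : IsBezout (R ⧸ I) :=
    Function.Surjective.isBezout (Ideal.Quotient.mk I) Ideal.Quotient.mk_surjective
  obtain ⟨e, h1, h2, h3⟩ := exists_idempotent_add_mem_nonZeroDivisors (hR I hT)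
    (Ideal.Quotient.mk I c)
  obtain ⟨e, rfl⟩ := Ideal.Quotient.mk_surjective e
  simp only [← Ideal.Quotient.eq_zero_iff_mem]
  refine ⟨e, ?_, by simpa using h2, fun w hw => h3 _ (by simpa using hw)⟩
  simp only [map_mul, map_sub, map_one]
  linear_combination -h1

/-- Every row `(a, b, c)` generating the unit ideal can be shortened: `R` has stable range at
most `2`. -/
theorem FractionallySelfFPInjective.exists_isCoprime_add_mul {R : Type u} [CommRing R]
    [IsBezout R] (hR : FractionallySelfFPInjective R) {a b c : R}
    (h : ∃ x y z, x * a + y * b + z * c = 1) : ∃ u v, IsCoprime (a + u * c) (b + v * c) := by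
  obtain ⟨r, s, t, h⟩ := h
  obtain ⟨d, a', b', x, y, ha, hb, hd⟩ := IsBezout.exists_common_factor a b
  obtain ⟨e, he, hde, hreg⟩ :=
    hR.exists_idempotent_mod (I := nilradical R) (Ideal.radical_isRadical _) d
  have hk : (1 - e) * (1 - x * a' - y * b') ∈ nilradical R := by
    apply hreg
    have : (d + e) * ((1 - e) * (1 - x * a' - y * b')) =
        (e * (1 - e)) * (1 - x * a' - y * b') := by
      linear_combination (1 - e) * (hd + x * ha + y * hb)
    rw [this]
    exact Ideal.mul_mem_right _ _ he
  refine ⟨e - (1 - e) * y, (1 - e) * x, ?_⟩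
  refine isCoprime_of_forall_field fun K _ φ h1 h2 => ?_
  have hnil {z : R} (hz : z ∈ nilradical R) : φ z = 0 :=
    ((mem_nilradical.1 hz).map φ).eq_zero
  replace he := hnil he
  replace hde := hnil hde
  replace hk := hnil hk
  apply_fun φ at h ha hb hd
  simp only [map_mul, map_add, map_sub, map_one] at *
  rcases mul_eq_zero.1 he with he | he
  · have hc : φ c = 0 := by
      rw [he] at hk h1 h2
      linear_combination φ a' * h2 - φ b' * h1 + φ c * hk - φ a' * hb + φ b' * ha
    rw [he, hc] at h1 h2
    refine one_ne_zero (α := K) ?_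
    linear_combination -h + φ r * h1 + φ s * h2 + φ t * hc
  · have he' : φ e = 1 := by linear_combination -he
    have hd0 : φ d = 0 := by simpa [he'] using hde
    rw [hd0, zero_mul] at ha hb
    have hc : φ c = 0 := by simpa [he', ha] using h1
    refine one_ne_zero (α := K) ?_
    linear_combination -h + φ r * ha + φ s * hb + φ t * hc

/-- A fractionally self fp-injective Bézout ring is Hermite: cofactors can be chosen coprime. -/
theorem FractionallySelfFPInjective.exists_isCoprime_factors {R : Type u} [CommRing R]
    [IsBezout R] (hR : FractionallySelfFPInjective R) (a b : R) :
    ∃ d a' b', a = d * a' ∧ b = d * b' ∧ IsCoprime a' b' := by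
  obtain ⟨d, a', b', x, y, ha, hb, hd⟩ := IsBezout.exists_common_factor a b
  obtain ⟨u, v, huv⟩ := hR.exists_isCoprime_add_mul (a := a') (b := b')
    (c := 1 - x * a' - y * b') ⟨x, y, 1, by ring⟩
  exact ⟨d, _, _, by linear_combination ha - u * (hd + x * ha + y * hb),
    by linear_combination hb - v * (hd + x * ha + y * hb), huv⟩

/-- A ring homomorphism to a field killing `a` kills the radical of `(a)`. -/
theorem map_eq_zero_of_mem_radical {R K : Type*} [CommRing R] [Field K] (φ : R →+* K) {a z : R}
    (ha : φ a = 0) (hz : z ∈ (Ideal.span {a}).radical) : φ z = 0 := by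
  obtain ⟨n, hn⟩ := hz
  obtain ⟨y, hy⟩ := Ideal.mem_span_singleton.1 hn
  refine eq_zero_of_pow_eq_zero (n := n) ?_
  rw [← map_pow, hy, map_mul, ha, zero_mul]

/-- The idempotents attached to the pairs `(c, √(a))` and `(a, √(c))` have no common zero on the
vanishing locus of `a` and `c`. -/
theorem false_of_map_eq_zero {R : Type u} [CommRing R] [IsBezout R] {a c e f : R}
    (he : e * (1 - e) ∈ (Ideal.span {a}).radical)
    (hce : ∀ w, (c + e) * w ∈ (Ideal.span {a}).radical → w ∈ (Ideal.span {a}).radical)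
    (hf : f * (1 - f) ∈ (Ideal.span {c}).radical)
    (haf : ∀ w, (a + f) * w ∈ (Ideal.span {c}).radical → w ∈ (Ideal.span {c}).radical)
    {K : Type*} [Field K] (φ : R →+* K) (ha : φ a = 0) (hc : φ c = 0) (hφe : φ e = 0)
    (hφf : φ f = 0) : False := by
  have key : ∀ {a c e : R}, e * (1 - e) ∈ (Ideal.span {a}).radical →
      (∀ w, (c + e) * w ∈ (Ideal.span {a}).radical → w ∈ (Ideal.span {a}).radical) →
      φ a = 0 → φ e = 0 → ∀ t r, φ t ≠ 0 → t * c = a * r → False := by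
    intro a c e he hce ha hφe t r ht htc
    have hmem : t * (1 - e) ∈ (Ideal.span {a}).radical := by
      apply hce
      have : (c + e) * (t * (1 - e)) = a * (r * (1 - e)) + e * (1 - e) * t := by
        linear_combination (1 - e) * htc
      rw [this]
      exact add_mem (Ideal.mul_mem_right _ _ (Ideal.le_radical (Ideal.mem_span_singleton_self _)))
        (Ideal.mul_mem_right _ _ he)
    have := map_eq_zero_of_mem_radical φ ha hmem
    simp [hφe, ht] at this
  obtain ⟨g, a', c', x, y, hga, hgc, hg⟩ := IsBezout.exists_common_factor a c
  by_cases ha' : φ a' = 0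
  · by_cases hc' : φ c' = 0
    · refine key he hce ha hφe (1 - x * a' - y * c') 0 (by simp [ha', hc']) ?_
      linear_combination (1 - x * a' - y * c') * hgc + c' * (hg + x * hga + y * hgc)
    · exact key hf haf hc hφf c' a' hc' (by linear_combination c' * hga - a' * hgc)
  · exact key he hce ha hφe a' c' ha' (by linear_combination a' * hgc - c' * hga)

/-- Kaplansky's criterion: a row `(a, b, c)` generating the unit ideal yields a triangular
`2 × 2` matrix equivalent to a diagonal one. -/
theorem FractionallySelfFPInjective.exists_isCoprime_mul_add_mul {R : Type u} [CommRing R]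
    [IsBezout R] (hR : FractionallySelfFPInjective R) {a b c : R}
    (h : ∃ x y z, x * a + y * b + z * c = 1) : ∃ p q, IsCoprime (p * a) (p * b + q * c) := by
  obtain ⟨r, p₀, q, h⟩ := h
  obtain ⟨e, he, hce, hcereg⟩ := hR.exists_idempotent_mod
    (Ideal.radical_isRadical (Ideal.span {a})) c
  obtain ⟨f, hf, haf, hafreg⟩ := hR.exists_idempotent_mod
    (Ideal.radical_isRadical (Ideal.span {c})) a
  obtain ⟨i₁, hi₁, i₂, hi₂, hi⟩ := Submodule.mem_sup.1 <| (Ideal.eq_top_iff_one _).1 <|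
    show Ideal.span {c, f * (1 - e)} ⊔ Ideal.span {a, e} = ⊤ by
      refine Ideal.eq_top_of_forall_field fun K _ φ hφ => ?_
      have hφc := hφ c (Ideal.mem_sup_left (Ideal.subset_span (by simp)))
      have hφf := hφ (f * (1 - e)) (Ideal.mem_sup_left (Ideal.subset_span (by simp)))
      have hφa := hφ a (Ideal.mem_sup_right (Ideal.subset_span (by simp)))
      have hφe := hφ e (Ideal.mem_sup_right (Ideal.subset_span (by simp)))
      exact false_of_map_eq_zero he hcereg hf hafreg φ hφa hφc hφe (by simpa [hφe] using hφf)
  obtain ⟨j₁, j₂, hj⟩ := Ideal.mem_span_pair.1 hi₁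
  obtain ⟨k₁, k₂, hk⟩ := Ideal.mem_span_pair.1 hi₂
  obtain ⟨p, hp⟩ : ∃ p, p = p₀ * i₁ + i₂ := ⟨_, rfl⟩
  have hpc : IsCoprime p c := by
    refine isCoprime_of_forall_field fun K _ φ hφp hφc => one_ne_zero (α := K) ?_
    have hf' := map_eq_zero_of_mem_radical φ hφc hf
    have haf' := map_eq_zero_of_mem_radical φ hφc haf
    have he' (ha : φ a = 0) := map_eq_zero_of_mem_radical φ ha he
    apply_fun φ at h hi hj hk hp
    simp only [map_mul, map_add, map_sub, map_one] at *
    by_cases hfe : φ f * (1 - φ e) = 0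
    · linear_combination -hi + hφp - hp + (φ p₀ - 1) * (hj - φ j₁ * hφc - φ j₂ * hfe)
    · obtain ⟨hf0, he1⟩ := mul_ne_zero_iff.1 hfe
      have ha : φ a = 0 := (mul_eq_zero.1 haf').resolve_right hf0
      have he0 : φ e = 0 := (mul_eq_zero.1 (he' ha)).resolve_right he1
      have hi2 : φ i₂ = 0 := by rw [← hk, ha, he0]; ring
      have hi1 : φ i₁ = 1 := by rw [← hi, hi2, add_zero]
      have hp0 : φ p₀ = 0 := by rw [← hφp, hp, hi1, hi2]; ring
      rw [← h, ha, hp0, hφc]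
      ring
  have hpa : IsCoprime (p * b + q * c) a := by
    refine isCoprime_of_forall_field fun K _ φ hφp hφa => one_ne_zero (α := K) ?_
    have he' := map_eq_zero_of_mem_radical φ hφa he
    have hce' := map_eq_zero_of_mem_radical φ hφa hce
    apply_fun φ at h hi hj hk hp
    simp only [map_mul, map_add, map_sub, map_one] at *
    rcases mul_eq_zero.1 he' with he0 | he1
    · have hi2 : φ i₂ = 0 := by rw [← hk, hφa, he0]; ring
      have hi1 : φ i₁ = 1 := by rw [← hi, hi2, add_zero]
      rw [hi1, hi2, mul_one, add_zero] at hp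
      rw [← h, hφa, ← hp]
      linear_combination hφp
    · have he0 : φ e = 1 := by linear_combination -he1
      have hc : φ c = 0 := by simpa [he0] using hce'
      have hi1 : φ i₁ = 0 := by rw [← hj, hc, he1]; ring
      have hi2 : φ i₂ = 1 := by rw [← hi, hi1, zero_add]
      have hb : φ b = 0 := by simpa [hp, hi1, hi2, hc] using hφp
      rw [← h, hφa, hb, hc]
      ring
  obtain ⟨g, p', q', hp', hq', hpq⟩ := hR.exists_isCoprime_factors p q
  have hpc' : IsCoprime p' c := hpc.of_isCoprime_of_dvd_left ⟨g, by rw [hp', mul_comm]⟩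
  have hpa' : IsCoprime (p' * b + q' * c) a :=
    hpa.of_isCoprime_of_dvd_left ⟨g, by rw [hp', hq']; ring⟩
  refine ⟨p', q', IsCoprime.mul_left ?_ hpa'.symm⟩
  rw [add_comm]
  exact (hpq.mul_right hpc').add_mul_left_right b

section Hermite

variable {R : Type*} [CommRing R]

/-- Over a Hermite ring every nonempty finite family is a multiple of a unimodular one. -/
theorem exists_eq_mul_of_hermite
    (hH : ∀ a b : R, ∃ d a' b', a = d * a' ∧ b = d * b' ∧ IsCoprime a' b')
    {ι : Type*} (x : ι → R) {s : Finset ι} (hs : s.Nonempty) :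
    ∃ (d : R) (y z : ι → R), (∀ i ∈ s, x i = d * y i) ∧ ∑ i ∈ s, y i * z i = 1 := by
  classical
  induction hs using Finset.Nonempty.cons_induction with
  | singleton j => exact ⟨x j, fun _ => 1, fun _ => 1, by simp, by simp⟩
  | cons j s hj _ ih =>
    obtain ⟨d, y, z, hxy, hyz⟩ := ih
    obtain ⟨g, α, β, hα, hβ, p, q, hpq⟩ := hH (x j) d
    have hne {i : ι} (hi : i ∈ s) : i ≠ j := fun h => hj (h ▸ hi)
    refine ⟨g, fun i => if i = j then α else β * y i, fun i => if i = j then p else q * z i,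
      fun i hi => ?_, ?_⟩
    · rcases Finset.mem_cons.1 hi with rfl | hi
      · simpa using hα
      · simp only [if_neg (hne hi)]
        rw [hxy i hi, hβ, mul_assoc]
    · have hsum : ∑ i ∈ s, (if i = j then α else β * y i) * (if i = j then p else q * z i) =
          β * q * ∑ i ∈ s, y i * z i := by
        rw [Finset.mul_sum]
        refine Finset.sum_congr rfl fun i hi => ?_
        rw [if_neg (hne hi), if_neg (hne hi), mul_mul_mul_comm]
      rw [Finset.sum_cons, hsum, hyz]
      simp only [if_true]
      linear_combination hpq

/-- Over a Hermite ring satisfying Kaplansky's criterion, a matrix whose entries generate the unit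
ideal represents `1` as a bilinear form. -/
theorem exists_bilinear_eq_one [IsBezout R]
    (hH : ∀ a b : R, ∃ d a' b', a = d * a' ∧ b = d * b' ∧ IsCoprime a' b')
    (hK : ∀ a b c : R, (∃ x y z, x * a + y * b + z * c = 1) →
      ∃ p q, IsCoprime (p * a) (p * b + q * c)) {m n : ℕ}
    (A Z : Fin (m + 1) → Fin (n + 1) → R) (hZ : ∑ i, A i ⬝ᵥ Z i = 1) :
    ∃ (u : Fin (m + 1) → R) (v : Fin (n + 1) → R), ∑ i, u i * (A i ⬝ᵥ v) = 1 := by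
  induction m with
  | zero => exact ⟨1, Z 0, by simpa using hZ⟩
  | succ m ih =>
    obtain ⟨d, w, w', hw, hw'⟩ := exists_eq_mul_of_hermite hH (A 0) Finset.univ_nonempty
    obtain ⟨c, B, B', hB, hB'⟩ := exists_eq_mul_of_hermite hH
      (fun k : Fin (m + 1) × Fin (n + 1) => A k.1.succ k.2) Finset.univ_nonempty
    rw [Fintype.sum_prod_type] at hB'
    obtain ⟨u, v, huv⟩ := ih (fun i j => B (i, j)) (fun i j => B' (i, j)) hB'
    have hA0 : A 0 = d • w := funext fun j => hw j (Finset.mem_univ _)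
    have hAs (i : Fin (m + 1)) : A i.succ = c • fun j => B (i, j) :=
      funext fun j => hB (i, j) (Finset.mem_univ _)
    let t : Fin (n + 1) → R := ∑ i, u i • fun j => B (i, j)
    have ht (x : Fin (n + 1) → R) : ∑ i, u i * ((fun j => B (i, j)) ⬝ᵥ x) = t ⬝ᵥ x := by
      simp only [t, sum_dotProduct, smul_dotProduct, smul_eq_mul]
    rw [ht] at huv
    have hdc : ∃ D C, D * d + C * c = 1 := by
      refine ⟨w ⬝ᵥ Z 0, ∑ i : Fin (m + 1), (fun j => B (i, j)) ⬝ᵥ Z i.succ, ?_⟩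
      rw [Fin.sum_univ_succ, hA0] at hZ
      simp only [hAs, smul_dotProduct, smul_eq_mul, ← Finset.mul_sum] at hZ
      linear_combination hZ
    obtain ⟨D, C, hDC⟩ := hdc
    -- the values of `w` on the kernel of `t` form a principal ideal
    let r : Fin (n + 1) → R := w - (w ⬝ᵥ v) • t
    obtain ⟨w₁, hw₁⟩ := (IsBezout.isPrincipal_of_FG (Ideal.span (Set.range r))
      (Submodule.fg_span (Set.finite_range r))).principal
    obtain ⟨k, hk⟩ : ∃ k : Fin (n + 1) → R, r = w₁ • k := by
      have (j : Fin (n + 1)) : ∃ k, r j = w₁ * k := by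
        have : r j ∈ Ideal.span (Set.range r) := Ideal.subset_span ⟨j, rfl⟩
        rw [hw₁] at this
        exact Ideal.mem_span_singleton.1 this
      choose k hk using this
      exact ⟨k, funext hk⟩
    obtain ⟨x, hx⟩ : ∃ x : Fin (n + 1) → R, r ⬝ᵥ x = w₁ := by
      have : w₁ ∈ Ideal.span (Set.range r) := hw₁ ▸ Submodule.mem_span_singleton_self w₁
      obtain ⟨x, hx⟩ := Ideal.mem_span_range_iff_exists_fun.1 this
      exact ⟨x, by rw [dotProduct_comm]; exact hx⟩
    have hwr : w = w₁ • k + (w ⬝ᵥ v) • t := by rw [← hk]; simp [r]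
    have hw1 : w₁ * (k ⬝ᵥ w') + (w ⬝ᵥ v) * (t ⬝ᵥ w') = 1 := by
      have : w ⬝ᵥ w' = 1 := hw'
      rw [hwr, add_dotProduct, smul_dotProduct, smul_dotProduct] at this
      simpa using this
    obtain ⟨p, q, α, β, hpq⟩ := hK (d * w₁) (d * (w ⬝ᵥ v)) c
      ⟨D * (k ⬝ᵥ w'), D * (t ⬝ᵥ w'), C, by linear_combination hDC + D * d * hw1⟩
    let z := x - (t ⬝ᵥ x) • v
    have htz : t ⬝ᵥ z = 0 := by simp [z, huv]
    have hwz : w ⬝ᵥ z = w₁ := by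
      simp only [r, sub_dotProduct, smul_dotProduct, smul_eq_mul] at hx
      simp only [z, dotProduct_sub, dotProduct_smul, smul_eq_mul]
      linear_combination hx
    refine ⟨Fin.cons p (q • u), α • z + β • v, ?_⟩
    have hsum (x : Fin (n + 1) → R) :
        ∑ i : Fin (m + 1), (q • u) i * (A i.succ ⬝ᵥ x) = q * c * (t ⬝ᵥ x) := by
      rw [← ht, Finset.mul_sum]
      refine Finset.sum_congr rfl fun i _ => ?_
      rw [hAs, smul_dotProduct, Pi.smul_apply, smul_eq_mul, smul_eq_mul]
      ring
    rw [Fin.sum_univ_succ]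
    simp only [Fin.cons_zero, Fin.cons_succ]
    rw [hsum, hA0]
    simp only [smul_dotProduct, smul_eq_mul, dotProduct_add, dotProduct_smul, htz, hwz, huv]
    linear_combination hpq

/-- Over a Hermite ring every unimodular row is the first row of an automorphism. -/
theorem exists_linearEquiv_apply_zero
    (hH : ∀ a b : R, ∃ d a' b', a = d * a' ∧ b = d * b' ∧ IsCoprime a' b') {n : ℕ}
    (u v : Fin (n + 1) → R) (huv : u ⬝ᵥ v = 1) :
    ∃ e : (Fin (n + 1) → R) ≃ₗ[R] (Fin (n + 1) → R), ∀ x, e x 0 = u ⬝ᵥ x := by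
  induction n with
  | zero =>
    have h0 : u 0 * v 0 = 1 := by simpa [dotProduct] using huv
    refine ⟨LinearEquiv.smulOfUnit ⟨u 0, v 0, h0, by rw [mul_comm, h0]⟩, fun x => ?_⟩
    simp [LinearEquiv.smulOfUnit, Units.smul_def, dotProduct]
  | succ n ih =>
    obtain ⟨d, y, z, hy, hyz⟩ := exists_eq_mul_of_hermite hH (Fin.tail u) Finset.univ_nonempty
    obtain ⟨e, he⟩ := ih y z hyz
    have hu : Fin.tail u = d • y := funext fun i => hy i (Finset.mem_univ _)
    have hdot (x : Fin (n + 2) → R) : u ⬝ᵥ x = u 0 * x 0 + d * (y ⬝ᵥ Fin.tail x) := by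
      rw [dotProduct, Fin.sum_univ_succ]
      congr 1
      rw [← smul_eq_mul, ← smul_dotProduct, ← hu]
      rfl
    obtain ⟨α, β, hαβ⟩ : ∃ α β, α * u 0 + β * d = 1 :=
      ⟨v 0, y ⬝ᵥ Fin.tail v, by rw [← huv, hdot]; ring⟩
    let S : (R × (Fin n → R)) ≃ₗ[R] (Fin (n + 1) → R) := Fin.consLinearEquiv R fun _ => R
    let T : (R × (Fin (n + 1) → R)) ≃ₗ[R] (Fin (n + 2) → R) := Fin.consLinearEquiv R fun _ => R
    let G : (R × R × (Fin n → R)) ≃ₗ[R] (R × R × (Fin n → R)) :=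
      { toFun s := (u 0 * s.1 + d * s.2.1, -β * s.1 + α * s.2.1, s.2.2)
        invFun s := (α * s.1 - d * s.2.1, β * s.1 + u 0 * s.2.1, s.2.2)
        map_add' s s' := by ext <;> simp <;> ring
        map_smul' r s := by ext <;> simp <;> ring
        left_inv s := by
          ext
          · linear_combination s.1 * hαβ
          · linear_combination s.2.1 * hαβ
          · rfl
        right_inv s := by
          ext
          · linear_combination s.1 * hαβ
          · linear_combination s.2.1 * hαβ
          · rfl }
    refine ⟨T.symm ≪≫ₗ (LinearEquiv.refl R R).prodCongr (e ≪≫ₗ S.symm) ≪≫ₗ G ≪≫ₗ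
      (LinearEquiv.refl R R).prodCongr S ≪≫ₗ T, fun x => ?_⟩
    rw [hdot, ← he]
    rfl

/-- The automorphism of `R ^ (n + 1)` fixing the first coordinate and acting by `e` on the
others. -/
def Fin.consAutomorphism {n : ℕ} (e : (Fin n → R) ≃ₗ[R] (Fin n → R)) :
    (Fin (n + 1) → R) ≃ₗ[R] (Fin (n + 1) → R) :=
  (Fin.consLinearEquiv R fun _ => R).symm ≪≫ₗ (LinearEquiv.refl R R).prodCongr e ≪≫ₗ
    Fin.consLinearEquiv R fun _ => R

theorem Fin.consAutomorphism_cons {n : ℕ} (e : (Fin n → R) ≃ₗ[R] (Fin n → R)) (r : R)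
    (x : Fin n → R) :
    Fin.consAutomorphism e (Fin.cons r x : Fin (n + 1) → R) =
      (Fin.cons r (e x) : Fin (n + 1) → R) :=
  rfl

/-- Over a Hermite ring satisfying Kaplansky's criterion every linear map between finite free
modules is diagonal in suitable bases. -/
theorem exists_linearEquiv_diagonal_s17 [IsBezout R]
    (hH : ∀ a b : R, ∃ d a' b', a = d * a' ∧ b = d * b' ∧ IsCoprime a' b')
    (hK : ∀ a b c : R, (∃ x y z, x * a + y * b + z * c = 1) →
      ∃ p q, IsCoprime (p * a) (p * b + q * c)) (m n : ℕ)
    (A : (Fin n → R) →ₗ[R] (Fin m → R)) :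
    ∃ (P : (Fin m → R) ≃ₗ[R] (Fin m → R)) (Q : (Fin n → R) ≃ₗ[R] (Fin n → R)),
      ∀ (i : Fin m) (j : Fin n), (i : ℕ) ≠ j → P (A (Q (Pi.single j 1))) i = 0 := by
  induction m generalizing n with
  | zero => exact ⟨.refl _ _, .refl _ _, fun i => i.elim0⟩
  | succ m ih =>
  cases n with
  | zero => exact ⟨.refl _ _, .refl _ _, fun _ j => j.elim0⟩
  | succ n =>
  obtain ⟨d, B, B', hB, hB'⟩ := exists_eq_mul_of_hermite hH
    (fun k : Fin (m + 1) × Fin (n + 1) => A (Pi.single k.2 1) k.1) Finset.univ_nonempty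
  rw [Fintype.sum_prod_type] at hB'
  obtain ⟨u, v, huv⟩ := exists_bilinear_eq_one hH hK (fun i j => B (i, j))
    (fun i j => B' (i, j)) hB'
  let N : Matrix (Fin (m + 1)) (Fin (n + 1)) R := Matrix.of fun i j => B (i, j)
  let b : (Fin (n + 1) → R) →ₗ[R] (Fin (m + 1) → R) := N.mulVecLin
  have hA : A = d • b := by
    refine LinearMap.pi_ext' fun j => LinearMap.ext_ring <| funext fun i => ?_
    simpa [b, N] using hB (i, j) (Finset.mem_univ _)
  let t : Fin (n + 1) → R := Matrix.vecMul u N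
  have ht (x : Fin (n + 1) → R) : u ⬝ᵥ b x = t ⬝ᵥ x := Matrix.dotProduct_mulVec u N x
  have htv : t ⬝ᵥ v = 1 := by rw [← ht]; exact huv
  obtain ⟨eu, heu⟩ := exists_linearEquiv_apply_zero hH u (b v) huv
  obtain ⟨et, het⟩ := exists_linearEquiv_apply_zero hH t v htv
  have hb (x : Fin (n + 1) → R) : eu (b (et.symm x)) 0 = x 0 := by
    rw [heu, ht, ← het, LinearEquiv.apply_symm_apply]
  let w : Fin (m + 1) → R := eu (b (et.symm (Pi.single 0 1))) - Pi.single 0 1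
  have hw : w 0 = 0 := by simp [w, hb]
  let L : (Fin (m + 1) → R) ≃ₗ[R] (Fin (m + 1) → R) :=
    { toFun y := y - y 0 • w
      invFun y := y + y 0 • w
      map_add' y y' := by simp only [Pi.add_apply, add_smul]; abel
      map_smul' r y := by simp [smul_sub, mul_smul]
      left_inv y := by simp [hw]
      right_inv y := by simp [hw] }
  let c : (Fin (n + 1) → R) →ₗ[R] (Fin (m + 1) → R) :=
    L.toLinearMap ∘ₗ eu.toLinearMap ∘ₗ b ∘ₗ et.symm.toLinearMap
  have hL (y : Fin (m + 1) → R) : L y = y - y 0 • w := rfl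
  have hc (x : Fin (n + 1) → R) : c x = L (eu (b (et.symm x))) := rfl
  have hc0 (x : Fin (n + 1) → R) : c x 0 = x 0 := by simp [hc, hL, hw, hb]
  have hc1 : c (Pi.single 0 1) = Pi.single 0 1 := by simp [hc, hL, hb, w]
  let C : (Fin n → R) →ₗ[R] (Fin m → R) :=
    LinearMap.funLeft R R Fin.succ ∘ₗ c ∘ₗ
      (Fin.consLinearEquiv R fun _ => R).toLinearMap ∘ₗ LinearMap.inr R R _
  have hC (x : Fin n → R) :
      c (Fin.cons 0 x : Fin (n + 1) → R) = (Fin.cons 0 (C x) : Fin (m + 1) → R) := by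
    ext i
    cases i using Fin.cases with
    | zero => rw [hc0]; rfl
    | succ i => rfl
  obtain ⟨P, Q, hPQ⟩ := ih n (d • C)
  refine ⟨eu ≪≫ₗ L ≪≫ₗ Fin.consAutomorphism P, Fin.consAutomorphism Q ≪≫ₗ et.symm,
    fun i j hij => ?_⟩
  have hval (x : Fin (n + 1) → R) :
      (eu ≪≫ₗ L ≪≫ₗ Fin.consAutomorphism P) (A ((Fin.consAutomorphism Q ≪≫ₗ et.symm) x)) =
        d • Fin.consAutomorphism P (c (Fin.consAutomorphism Q x)) := by
    simp [hA, hc]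
  have hsingle (k : ℕ) : (Pi.single 0 1 : Fin (k + 1) → R) = Fin.cons 1 0 := by
    ext i
    cases i using Fin.cases <;> simp
  have hsucc (k : Fin n) : (Pi.single k.succ 1 : Fin (n + 1) → R) = Fin.cons 0 (Pi.single k 1) := by
    ext i
    cases i using Fin.cases <;> simp [Pi.single_apply]
  rw [hval]
  cases j using Fin.cases with
  | zero =>
    rw [hsingle, Fin.consAutomorphism_cons, map_zero, ← hsingle, hc1, hsingle,
      Fin.consAutomorphism_cons, map_zero]
    cases i using Fin.cases with
    | zero => exact absurd rfl hij
    | succ i => simp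
  | succ j =>
    rw [hsucc, Fin.consAutomorphism_cons, hC, Fin.consAutomorphism_cons]
    cases i using Fin.cases with
    | zero => simp
    | succ i => simpa using hPQ i j (by simpa using hij)

end Hermite

/-- Every commutative fractionally self fp-injective Bézout ring is a
Kaplansky ring. -/
theorem isKaplanskyRing_of_fractionallySelfFPInjective_of_isBezout (R : Type u)
    [CommRing R] [IsBezout R] (hR : FractionallySelfFPInjective R) :
    IsKaplanskyRing R := by
  intro m n A
  obtain ⟨P, Q, hPQ⟩ := exists_linearEquiv_diagonal_s17 hR.exists_isCoprime_factors
    (fun _ _ _ => hR.exists_isCoprime_mul_add_mul) m n (Matrix.toLin' A)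
  have hunit {k : ℕ} (e : (Fin k → R) ≃ₗ[R] (Fin k → R)) :
      IsUnit (LinearMap.toMatrix' e.toLinearMap) :=
    ((Module.End.isUnit_iff e.toLinearMap).2 e.bijective).map LinearMap.toMatrixAlgEquiv'
  refine ⟨LinearMap.toMatrix' P.toLinearMap, LinearMap.toMatrix' Q.toLinearMap, hunit P, hunit Q,
    fun i j hij => ?_⟩
  rw [← LinearMap.toMatrix'_toLin' A, ← LinearMap.toMatrix'_comp, ← LinearMap.toMatrix'_comp,
    LinearMap.toMatrix'_apply]
  simpa [← Pi.single_apply] using hPQ i j hij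
end

section
/- Every commutative arithmetic ring of Krull dimension 0 is a Kaplansky ring and an adequate ring. -/
open DirectSum

universe u

section

variable {R : Type u} [CommRing R]

/-- In a zero-dimensional ring every element is, up to an idempotent, a unit or nilpotent. -/
theorem exists_isIdempotentElem_dvd_of_krullDimZero
    (hdim : ∀ P : Ideal R, P.IsPrime → P.IsMaximal) (s : R) :
    ∃ e : R, IsIdempotentElem e ∧ s ∣ e ∧ IsNilpotent (s * (1 - e)) := by
  obtain ⟨n, x, h⟩ : ∃ (n : ℕ) (x : R), s ^ n * (1 - s * x) = 0 := by
    by_contra! hne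
    let S : Submonoid R :=
      { carrier := {y | ∃ (n : ℕ) (x : R), y = s ^ n * (1 - s * x)}
        one_mem' := ⟨0, 0, by simp⟩
        mul_mem' := by
          rintro _ _ ⟨n, x, rfl⟩ ⟨m, y, rfl⟩
          exact ⟨n + m, x + y - s * x * y, by ring⟩ }
    have hdisj : Disjoint ((⊥ : Ideal R) : Set R) (S : Set R) := by
      rw [Set.disjoint_left]
      rintro y hy ⟨n, x, hx⟩
      have hy0 : y = 0 := by simpa using hy
      exact hne n x (by rw [← hx, hy0])
    obtain ⟨P, hP, -, hPS⟩ := Ideal.exists_le_prime_disjoint ⊥ S hdisj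
    rw [Set.disjoint_left] at hPS
    have hs : s ∉ P := fun hs => hPS hs ⟨1, 0, by simp⟩
    obtain ⟨y, i, hi, hy⟩ := (hdim P hP).exists_inv hs
    exact hPS hi ⟨0, y, by linear_combination hy⟩
  have h₁ : s ^ (n + 1) * (1 - s * x) = 0 := by
    rw [pow_succ]
    linear_combination s * h
  have hstep : ∀ k : ℕ, s ^ (n + 1) * (s * x) ^ k = s ^ (n + 1) := by
    intro k
    induction k with
    | zero => simp
    | succ k ih =>
      rw [pow_succ (s * x), ← mul_assoc, ih]
      linear_combination -h₁
  have he : IsIdempotentElem ((s * x) ^ (n + 1)) := by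
    have hk := hstep (n + 1)
    have hp : (s * x) ^ (n + 1) = s ^ (n + 1) * x ^ (n + 1) := mul_pow _ _ _
    unfold IsIdempotentElem
    linear_combination x ^ (n + 1) * hk + ((s * x) ^ (n + 1) - 1) * hp
  refine ⟨_, he, (dvd_mul_right s x).trans (dvd_pow_self _ n.succ_ne_zero), n + 1, ?_⟩
  rw [mul_pow, he.one_sub.pow_succ_eq]
  linear_combination -hstep (n + 1)

/-- Two elements of a zero-dimensional arithmetic ring become comparable for divisibility after
splitting the ring by an idempotent. -/
theorem IsArithmetic.exists_isIdempotentElem_dvd (hR : IsArithmetic R)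
    (hdim : ∀ P : Ideal R, P.IsPrime → P.IsMaximal) (a b : R) :
    ∃ e : R, IsIdempotentElem e ∧ b ∣ e * a ∧ a ∣ (1 - e) * b := by
  let I : R → R → Ideal R := fun a b => Submodule.comap (LinearMap.mulRight R a) (Ideal.span {b})
  have hI : ∀ a b s, s ∈ I a b ↔ b ∣ s * a := fun a b s => by
    simp [I, Ideal.mem_span_singleton]
  have htop : I a b ⊔ I b a = ⊤ := by
    by_contra hne
    obtain ⟨M, hM, hle⟩ := Ideal.exists_le_maximal _ hne
    have := hM.isPrime
    have key : ∀ a b : R, Ideal.span {algebraMap R (Localization.AtPrime M) a} ≤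
        Ideal.span {algebraMap R (Localization.AtPrime M) b} → ¬ I a b ≤ M := by
      intro a b hab hIM
      rw [Ideal.span_singleton_le_span_singleton] at hab
      obtain ⟨q, hq⟩ := hab
      obtain ⟨c, s, rfl⟩ := IsLocalization.exists_mk'_eq M.primeCompl q
      rw [IsLocalization.mul_mk'_eq_mk'_of_mul, IsLocalization.eq_mk'_iff_mul_eq, ← map_mul,
        IsLocalization.eq_iff_exists M.primeCompl] at hq
      obtain ⟨t, ht⟩ := hq
      refine (t * s).2 (hIM ((hI _ _ _).2 ⟨t * c, ?_⟩))
      push_cast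
      linear_combination ht
    rcases hR M hM (Ideal.span {algebraMap R _ a}) (Ideal.span {algebraMap R _ b}) with h | h
    · exact key a b h (le_sup_left.trans hle)
    · exact key b a h (le_sup_right.trans hle)
  obtain ⟨s, hs, t, ht, hst⟩ := Submodule.mem_sup.1 ((Ideal.eq_top_iff_one _).1 htop)
  obtain ⟨e, he, hse, hnil⟩ := exists_isIdempotentElem_dvd_of_krullDimZero hdim s
  refine ⟨e, he, (hI _ _ _).1 ((I a b).mem_of_dvd hse hs), (hI _ _ _).1 ?_⟩
  obtain ⟨v, hv⟩ := hnil.isUnit_one_sub.exists_left_inv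
  have he' : e * e = e := he
  have : 1 - e = v * (1 - e) * t := by
    linear_combination (-(1 - e)) * hv - v * (1 - e) * hst - v * s * he'
  rw [this]
  exact Ideal.mul_mem_left _ _ ht

/-- A property of idempotents that can be checked after splitting holds as soon as it holds for
those idempotents over which some member of a given finite family divides all the others. -/
theorem IsArithmetic.idempotent_induction (hR : IsArithmetic R)
    (hdim : ∀ P : Ideal R, P.IsPrime → P.IsMaximal) {ι : Type*} (a : ι → R) (p : R → Prop)
    (hsplit : ∀ e f : R, IsIdempotentElem f → p (e * f) → p (e * (1 - f)) → p e)
    {s : Finset ι} (hs : s.Nonempty)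
    (hp : ∀ e : R, IsIdempotentElem e → ∀ k ∈ s, (∀ j ∈ s, a k ∣ e * a j) → p e) : p 1 := by
  classical
  suffices h : ∀ e : R, IsIdempotentElem e → p e from h 1 IsIdempotentElem.one
  induction hs using Finset.Nonempty.cons_induction with
  | singleton i =>
    intro e he
    exact hp e he i (by simp) (by simp)
  | cons i s hi hs ih =>
    refine ih fun e he k hk hdvd => ?_
    obtain ⟨f, hf, h₁, h₂⟩ := hR.exists_isIdempotentElem_dvd hdim (a i) (a k)
    refine hsplit e f hf (hp _ (he.mul hf) k (by simp [hk]) fun j hj => ?_)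
      (hp _ (he.mul hf.one_sub) i (by simp) fun j hj => ?_)
    · rcases Finset.mem_cons.1 hj with rfl | hj
      · rw [mul_assoc]
        exact h₁.mul_left _
      · rw [mul_right_comm]
        exact (hdvd j hj).mul_right _
    · rcases Finset.mem_cons.1 hj with rfl | hj
      · exact dvd_mul_left _ _
      · rw [mul_comm e, mul_assoc]
        exact h₂.trans (mul_dvd_mul_left _ (hdvd j hj))

theorem IsArithmetic.isBezout (hR : IsArithmetic R)
    (hdim : ∀ P : Ideal R, P.IsPrime → P.IsMaximal) : IsBezout R := by
  rw [IsBezout.iff_span_pair_isPrincipal]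
  intro a b
  obtain ⟨e, he, ⟨x, hx⟩, ⟨y, hy⟩⟩ := hR.exists_isIdempotentElem_dvd hdim a b
  have he' : e * e = e := he
  refine ⟨(1 - e) * a + e * b, le_antisymm ?_ ?_⟩
  · rw [Ideal.submodule_span_eq, Ideal.span_le]
    rintro z (rfl | rfl) <;> rw [SetLike.mem_coe, Ideal.mem_span_singleton]
    · exact ⟨(1 - e) + e * x, by
        linear_combination e * hx + (x * z - x * b + b - 2 * z) * he'⟩
    · exact ⟨e + (1 - e) * y, by
        linear_combination (1 - e) * hy + (y * z - y * a + a - 2 * z) * he'⟩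
  · rw [Ideal.submodule_span_eq, Ideal.span_singleton_le_iff_mem]
    exact Ideal.mem_span_pair.2 ⟨_, _, rfl⟩

theorem IsArithmetic.isAdequateRing (hR : IsArithmetic R)
    (hdim : ∀ P : Ideal R, P.IsPrime → P.IsMaximal) : IsAdequateRing R := by
  refine ⟨hR.isBezout hdim, fun a b _ => ?_⟩
  obtain ⟨e, he, ⟨x, hx⟩, hnil⟩ := exists_isIdempotentElem_dvd_of_krullDimZero hdim b
  have he' : e * e = e := he
  refine ⟨e * a + (1 - e), e + (1 - e) * a, ?_, ?_, ?_⟩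
  · linear_combination (a - 1) ^ 2 * he'
  · rw [Submodule.add_eq_sup, ← Ideal.span_insert, Ideal.eq_top_iff_one, Ideal.mem_span_pair]
    exact ⟨1 - e, x, by linear_combination (1 - a) * he' - hx⟩
  · rintro s' hs' ⟨c, hc⟩ htop
    obtain ⟨M, hM, hs'M⟩ := exists_max_ideal_of_mem_nonunits hs'
    have := hM.isPrime
    have heM : e ∈ M := by
      have : e = s' * (c * e) := by linear_combination e * hc + (a - 1) * he'
      rw [this]
      exact M.mul_mem_right _ hs'M
    have hbM : b ∈ M := by
      obtain ⟨n, hn⟩ := hnil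
      have hmem : b * (1 - e) ∈ M := hM.isPrime.mem_of_pow_mem n (hn ▸ M.zero_mem)
      have := M.add_mem hmem (M.mul_mem_left b heM)
      rwa [← mul_add, sub_add_cancel, mul_one] at this
    refine hM.ne_top (top_le_iff.1 (htop ▸ sup_le ?_ ?_))
    · exact (Ideal.span_singleton_le_iff_mem _).2 hs'M
    · exact (Ideal.span_singleton_le_iff_mem _).2 hbM

/-- `A` admits a diagonal reduction after multiplication by `e`. -/
def HasDiagonalReductionOn {m n : ℕ} (A : Matrix (Fin m) (Fin n) R) (e : R) : Prop :=
  ∃ (P : Matrix (Fin m) (Fin m) R) (Q : Matrix (Fin n) (Fin n) R),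
    IsUnit P ∧ IsUnit Q ∧ ∀ (i : Fin m) (j : Fin n), (i : ℕ) ≠ (j : ℕ) → e * (P * A * Q) i j = 0

theorem IsIdempotentElem.isUnit_smul_add_smul {S : Type*} [Ring S] [Algebra R S] {f : R}
    (hf : IsIdempotentElem f) {x y : S} (hx : IsUnit x) (hy : IsUnit y) :
    IsUnit (f • x + (1 - f) • y) := by
  have hf' : f * f = f := hf
  have h₀ : f * (1 - f) = 0 := by linear_combination -hf'
  have h₁ : (1 - f) * f = 0 := by linear_combination -hf'
  have h₂ : (1 - f) * (1 - f) = 1 - f := hf.one_sub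
  obtain ⟨u, rfl⟩ := hx
  obtain ⟨v, rfl⟩ := hy
  refine ⟨⟨_, f • (↑u⁻¹ : S) + (1 - f) • (↑v⁻¹ : S), ?_, ?_⟩, rfl⟩ <;>
  · simp only [add_mul, mul_add, smul_mul_smul_comm, hf', h₀, h₁, h₂, zero_smul, Units.mul_inv,
      Units.inv_mul, add_zero, zero_add]
    rw [← add_smul, add_sub_cancel, one_smul]

namespace HasDiagonalReductionOn

theorem of_split {m n : ℕ} {A : Matrix (Fin m) (Fin n) R} {e f : R} (hf : IsIdempotentElem f)
    (h₁ : HasDiagonalReductionOn A (e * f)) (h₂ : HasDiagonalReductionOn A (e * (1 - f))) :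
    HasDiagonalReductionOn A e := by
  obtain ⟨P₁, Q₁, hP₁, hQ₁, h₁⟩ := h₁
  obtain ⟨P₂, Q₂, hP₂, hQ₂, h₂⟩ := h₂
  refine ⟨f • P₁ + (1 - f) • P₂, f • Q₁ + (1 - f) • Q₂, hf.isUnit_smul_add_smul hP₁ hP₂,
    hf.isUnit_smul_add_smul hQ₁ hQ₂, fun i j hij => ?_⟩
  have hf' : f * f = f := hf
  have e₁ := h₁ i j hij
  have e₂ := h₂ i j hij
  simp only [Matrix.add_mul, Matrix.mul_add, Matrix.smul_mul, Matrix.mul_smul, Matrix.add_apply,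
    Matrix.smul_apply, smul_eq_mul]
  linear_combination e₁ + e₂ + e * ((P₁ * A * Q₁) i j + (P₂ * A * Q₂) i j
    - (P₁ * A * Q₂) i j - (P₂ * A * Q₁) i j) * hf'

theorem of_mul {m n : ℕ} {A : Matrix (Fin m) (Fin n) R} {e : R}
    {L : Matrix (Fin m) (Fin m) R} {U : Matrix (Fin n) (Fin n) R} (hL : IsUnit L) (hU : IsUnit U)
    (h : HasDiagonalReductionOn (L * A * U) e) : HasDiagonalReductionOn A e := by
  obtain ⟨P, Q, hP, hQ, h⟩ := h
  refine ⟨P * L, U * Q, hP.mul hL, hU.mul hQ, ?_⟩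
  simpa only [Matrix.mul_assoc] using h

theorem of_submatrix {m n : ℕ} {A : Matrix (Fin m) (Fin n) R} {e : R}
    (σ : Equiv.Perm (Fin m)) (τ : Equiv.Perm (Fin n))
    (h : HasDiagonalReductionOn (A.submatrix σ τ) e) : HasDiagonalReductionOn A e := by
  refine of_mul (L := (1 : Matrix _ _ R).submatrix (Equiv.refl _) σ.symm)
    (U := (1 : Matrix _ _ R).submatrix τ.symm (Equiv.refl _))
    ((Matrix.isUnit_submatrix_equiv _ _).2 isUnit_one)
    ((Matrix.isUnit_submatrix_equiv _ _).2 isUnit_one) ?_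
  convert h using 1
  ext i j
  simp [Matrix.mul_apply, Matrix.one_apply, Equiv.symm_apply_eq, Equiv.eq_symm_apply]

end HasDiagonalReductionOn

/-- The block diagonal matrix with blocks `1` and `P`. -/
def Matrix.oneBlock {m : ℕ} (P : Matrix (Fin m) (Fin m) R) :
    Matrix (Fin (m + 1)) (Fin (m + 1)) R :=
  Matrix.of (Fin.cons (Fin.cons 1 0) fun i => Fin.cons 0 (P i))

theorem Matrix.oneBlock_mul {m : ℕ} (P Q : Matrix (Fin m) (Fin m) R) :
    (P * Q).oneBlock = P.oneBlock * Q.oneBlock := by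
  ext i j
  refine Fin.cases ?_ (fun i => ?_) i <;> refine Fin.cases ?_ (fun j => ?_) j <;>
    simp [Matrix.oneBlock, Matrix.mul_apply, Fin.sum_univ_succ]

theorem Matrix.oneBlock_one {m : ℕ} : (1 : Matrix (Fin m) (Fin m) R).oneBlock = 1 := by
  ext i j
  refine Fin.cases ?_ (fun i => ?_) i <;> refine Fin.cases ?_ (fun j => ?_) j <;>
    simp [Matrix.oneBlock, Matrix.one_apply, Fin.succ_ne_zero, (Fin.succ_ne_zero _).symm]

theorem Matrix.isUnit_oneBlock {m : ℕ} {P : Matrix (Fin m) (Fin m) R} (hP : IsUnit P) :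
    IsUnit P.oneBlock := by
  obtain ⟨u, rfl⟩ := hP
  refine ⟨⟨u.val.oneBlock, (↑u⁻¹ : Matrix _ _ R).oneBlock, ?_, ?_⟩, rfl⟩
  · rw [← Matrix.oneBlock_mul, Units.mul_inv, Matrix.oneBlock_one]
  · rw [← Matrix.oneBlock_mul, Units.inv_mul, Matrix.oneBlock_one]

theorem Matrix.isUnit_one_sub_vecMulVec {m : ℕ} {x y : Fin m → R} (h : y ⬝ᵥ x = 0) :
    IsUnit (1 - Matrix.vecMulVec x y) := by
  refine IsNilpotent.isUnit_one_sub ⟨2, ?_⟩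
  rw [pow_two, Matrix.vecMulVec_mul_vecMulVec, h]
  ext
  simp [Matrix.vecMulVec_apply]

namespace HasDiagonalReductionOn

theorem of_first_row_col {m n : ℕ} {A : Matrix (Fin (m + 1)) (Fin (n + 1)) R} {e : R}
    (hrow : ∀ j : Fin n, e * A 0 j.succ = 0) (hcol : ∀ i : Fin m, e * A i.succ 0 = 0)
    (h : HasDiagonalReductionOn (A.submatrix Fin.succ Fin.succ) e) :
    HasDiagonalReductionOn A e := by
  obtain ⟨P, Q, hP, hQ, h⟩ := h
  refine ⟨P.oneBlock, Q.oneBlock, Matrix.isUnit_oneBlock hP, Matrix.isUnit_oneBlock hQ,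
    fun i j => ?_⟩
  refine Fin.cases ?_ (fun i => ?_) i <;> refine Fin.cases ?_ (fun j => ?_) j <;> intro hij
  · simp at hij
  · simp [Matrix.oneBlock, Matrix.mul_apply, Fin.sum_univ_succ, Finset.mul_sum, ← mul_assoc, hrow]
  · simp [Matrix.oneBlock, Matrix.mul_apply, Fin.sum_univ_succ, Finset.mul_sum,
      mul_left_comm e, hcol]
  · have := h i j (by simpa using hij)
    simpa [Matrix.oneBlock, Matrix.mul_apply, Fin.sum_univ_succ] using this

theorem of_dvd {m n : ℕ} {A : Matrix (Fin (m + 1)) (Fin (n + 1)) R} {e : R}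
    (he : IsIdempotentElem e) (hA : ∀ i j, A 0 0 ∣ e * A i j)
    (ih : ∀ B : Matrix (Fin m) (Fin n) R, HasDiagonalReductionOn B e) :
    HasDiagonalReductionOn A e := by
  choose c hc using hA
  have he' : e * e = e := he
  refine of_mul
    (L := 1 - Matrix.vecMulVec (Fin.cons 0 fun i : Fin m => c i.succ 0) (Pi.single 0 1))
    (U := 1 - Matrix.vecMulVec (Pi.single 0 1) (Fin.cons 0 fun j : Fin n => c 0 j.succ))
    (Matrix.isUnit_one_sub_vecMulVec (by simp)) (Matrix.isUnit_one_sub_vecMulVec (by simp))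
    (of_first_row_col (fun j => ?_) (fun i => ?_) (ih _))
  · have := hc 0 j.succ
    simp [Matrix.sub_mul, Matrix.mul_sub, Matrix.vecMulVec_mul, Matrix.mul_vecMulVec,
      Matrix.vecMulVec_apply]
    linear_combination e * this - A 0 j.succ * he'
  · have := hc i.succ 0
    simp [Matrix.sub_mul, Matrix.mul_sub, Matrix.vecMulVec_mul, Matrix.mul_vecMulVec,
      Matrix.vecMulVec_apply]
    linear_combination e * this - A i.succ 0 * he'

end HasDiagonalReductionOn

theorem IsArithmetic.isKaplanskyRing (hR : IsArithmetic R)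
    (hdim : ∀ P : Ideal R, P.IsPrime → P.IsMaximal) : IsKaplanskyRing R := by
  suffices h : ∀ (m n : ℕ) (A : Matrix (Fin m) (Fin n) R), HasDiagonalReductionOn A 1 by
    simpa only [IsKaplanskyRing, HasDiagonalReductionOn, one_mul] using h
  intro m
  induction m with
  | zero => exact fun n A => ⟨1, 1, isUnit_one, isUnit_one, fun i => i.elim0⟩
  | succ m ih =>
    rintro (_ | n) A
    · exact ⟨1, 1, isUnit_one, isUnit_one, fun _ j => j.elim0⟩
    refine hR.idempotent_induction hdim (fun k : Fin (m + 1) × Fin (n + 1) => A k.1 k.2)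
      (HasDiagonalReductionOn A) (fun e f hf => .of_split hf) Finset.univ_nonempty
      fun e he k _ hk => ?_
    refine .of_submatrix (Equiv.swap 0 k.1) (Equiv.swap 0 k.2)
      (.of_dvd he (fun i j => ?_) fun B => ?_)
    · simpa using hk (Equiv.swap 0 k.1 i, Equiv.swap 0 k.2 j) (Finset.mem_univ _)
    · obtain ⟨P, Q, hP, hQ, h⟩ := ih n B
      exact ⟨P, Q, hP, hQ, fun i j hij => by simpa using congrArg (e * ·) (h i j hij)⟩

end

/-- Every commutative arithmetic ring of Krull dimension 0 is a Kaplansky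
ring and an adequate ring. -/
theorem isKaplansky_and_isAdequate_of_isArithmetic_krullDimZero (R : Type u) [CommRing R]
    (hR : IsArithmetic R) (hdim : ∀ P : Ideal R, P.IsPrime → P.IsMaximal) :
    IsKaplanskyRing R ∧ IsAdequateRing R :=
  ⟨hR.isKaplanskyRing hdim, hR.isAdequateRing hdim⟩
end
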